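/- arXiv:1507.07910 — 2 statements merged into one kernel-verified Lean document; each statement's English description precedes it below -/
import Mathlib

section
/- Fix an environment e. (i) P^e_{αi}(lim_{n→∞} X_n = +∞) = 1 for every (α,i) ∈ {1,…,m}×ℤ if and only if for every (α,i,ℓ) ∈ {1,…,m}×ℤ², P^e_{αi}(τ_ℓ < ∞) = 1 when i < ℓ and P^e_{αi}(τ_ℓ < ∞) < 1 when i > ℓ. (ii) P^e_{αi}(lim_{n→∞} X_n = −∞) = 1 for every (α,i) if and only if for every (α,i,ℓ), P^e_{αi}(τ_ℓ < ∞) = 1 when i > ℓ and P^e_{αi}(τ_ℓ < ∞) < 1 when i < ℓ. (iii) If in addition the Markov chain G_n on {1,…,m} with transition matrix Q is irreducible, then P^e_{αi}(liminf_{n→∞} X_n = −∞ and limsup_{n→∞} X_n = +∞) = 1 for every (α,i) if and only if P^e_{αℓ}(τ_ℓ < ∞) = 1 for every (α,ℓ) ∈ {1,…,m}×ℤ. -/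
open MeasureTheory Filter Matrix
open scoped ENNReal Topology

namespace Parrondo

/-- One-step transition probability of the regime-switching random walk:
`P_{αi,βj} = Q_{αβ} P^{(β)}_{ij}` with `P^{(β)}_{i,i+1} = p^{(β)}_i`,
`P^{(β)}_{i,i-1} = 1 - p^{(β)}_i`. -/
noncomputable def step {ι : Type*} (Q : Matrix ι ι ℝ) (p : ι → ℤ → ℝ) (s s' : ι × ℤ) : ℝ :=
  Q s.1 s'.1 *
    (if s'.2 = s.2 + 1 then p s'.1 s.2
     else if s'.2 = s.2 - 1 then 1 - p s'.1 s.2 else 0)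

/-- `μ α i` is the quenched law of the regime-switching walk `(G_n, X_n)` started at `(α, i)`,
characterized by its values on cylinder sets. -/
def IsQuenchedLaw {ι : Type*} [DecidableEq ι] [MeasurableSpace ι]
    (Q : Matrix ι ι ℝ) (p : ι → ℤ → ℝ) (μ : ι → ℤ → Measure (ℕ → ι × ℤ)) : Prop :=
  ∀ (α : ι) (i : ℤ),
    IsProbabilityMeasure (μ α i) ∧
    ∀ (n : ℕ) (traj : ℕ → ι × ℤ),
      μ α i {ω | ∀ k ≤ n, ω k = traj k} =
        (if traj 0 = (α, i) then 1 else 0) *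
          ENNReal.ofReal (∏ k ∈ Finset.range n, step Q p (traj k) (traj (k + 1)))

/-- The event `{τ_ℓ < ∞}` where `τ_ℓ = inf {n ≥ 1 : X_n = ℓ}`. -/
def hitEvent {ι : Type*} (ℓ : ℤ) : Set (ℕ → ι × ℤ) := {ω | ∃ n : ℕ, 1 ≤ n ∧ (ω n).2 = ℓ}

/-- The event `{τ_ℓ < ∞, G_{τ_ℓ} = β}`. -/
def hitRegimeEvent {ι : Type*} (ℓ : ℤ) (β : ι) : Set (ℕ → ι × ℤ) :=
  {ω | ∃ n : ℕ, 1 ≤ n ∧ (ω n).2 = ℓ ∧ (ω n).1 = β ∧ ∀ k, 1 ≤ k → k < n → (ω k).2 ≠ ℓ}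

/-- The event `{X_n ≤ ℓ infinitely often}`. -/
def belowIO {ι : Type*} (ℓ : ℤ) : Set (ℕ → ι × ℤ) := {ω | ∃ᶠ n in atTop, (ω n).2 ≤ ℓ}

/-- The event `{lim_n X_n = +∞}`. -/
def driftTop {ι : Type*} : Set (ℕ → ι × ℤ) := {ω | Tendsto (fun n => (ω n).2) atTop atTop}

/-- The event `{lim_n X_n = -∞}`. -/
def driftBot {ι : Type*} : Set (ℕ → ι × ℤ) := {ω | Tendsto (fun n => (ω n).2) atTop atBot}

/-- The event `{liminf_n X_n = -∞ and limsup_n X_n = +∞}`. -/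
def oscillate {ι : Type*} : Set (ℕ → ι × ℤ) :=
  {ω | (∀ M : ℤ, ∃ᶠ n in atTop, (ω n).2 < M) ∧ ∀ M : ℤ, ∃ᶠ n in atTop, M < (ω n).2}

/-- `‖f_{iℓ}‖ = max_α P_{αi}(τ_ℓ < ∞)`. -/
noncomputable def fnorm {ι : Type*} [Fintype ι] [MeasurableSpace ι]
    (μ : ι → ℤ → Measure (ℕ → ι × ℤ)) (i ℓ : ℤ) : ℝ :=
  ⨆ α : ι, (μ α i (hitEvent ℓ)).toReal

/-- One step of the chain `(G_n, X_n)` has positive probability (the probabilities `p` being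
in `(0,1)`, this only depends on `Q`). -/
def StepPos {ι : Type*} (Q : Matrix ι ι ℝ) (s s' : ι × ℤ) : Prop :=
  0 < Q s.1 s'.1 ∧ (s'.2 = s.2 + 1 ∨ s'.2 = s.2 - 1)

/-- Irreducibility of the Markov chain `(G_n, X_n)`. -/
def ChainIrreducible {ι : Type*} (Q : Matrix ι ι ℝ) : Prop :=
  ∀ s s' : ι × ℤ, ∃ (n : ℕ) (c : ℕ → ι × ℤ),
    c 0 = s ∧ c n = s' ∧ ∀ k < n, StepPos Q (c k) (c (k + 1))

/-- Irreducibility of the Markov chain `G_n` with transition matrix `Q`. -/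
def MatIrreducible {ι : Type*} (Q : Matrix ι ι ℝ) : Prop :=
  ∀ α β : ι, ∃ (n : ℕ) (g : ℕ → ι), g 0 = α ∧ g n = β ∧ ∀ k < n, 0 < Q (g k) (g (k + 1))

/-- One-step transition probability of a nearest-neighbour random walk on `ℤ`. -/
noncomputable def stepRW (p : ℤ → ℝ) (i j : ℤ) : ℝ :=
  if j = i + 1 then p i else if j = i - 1 then 1 - p i else 0

/-- `μ i` is the quenched law of the nearest-neighbour walk on `ℤ` started at `i`. -/
def IsRWLaw (p : ℤ → ℝ) (μ : ℤ → Measure (ℕ → ℤ)) : Prop :=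
  ∀ i : ℤ,
    IsProbabilityMeasure (μ i) ∧
    ∀ (n : ℕ) (traj : ℕ → ℤ),
      μ i {ω | ∀ k ≤ n, ω k = traj k} =
        (if traj 0 = i then 1 else 0) *
          ENNReal.ofReal (∏ k ∈ Finset.range n, stepRW p (traj k) (traj (k + 1)))

def driftTopZ : Set (ℕ → ℤ) := {ω | Tendsto ω atTop atTop}

def driftBotZ : Set (ℕ → ℤ) := {ω | Tendsto ω atTop atBot}

def oscillateZ : Set (ℕ → ℤ) :=
  {ω | (∀ M : ℤ, ∃ᶠ n in atTop, ω n < M) ∧ ∀ M : ℤ, ∃ᶠ n in atTop, M < ω n}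

/-- A norm on matrices (all norms being equivalent, the choice is irrelevant). -/
noncomputable def matNorm {ι : Type*} [Fintype ι] (B : Matrix ι ι ℝ) : ℝ :=
  ⨆ x : ι × ι, |B x.1 x.2|

/-- `prodA A n = A_n ⋯ A_1`. -/
def prodA {ι : Type*} [Fintype ι] [DecidableEq ι]
    (A : ℤ → Matrix ι ι ℝ) : ℕ → Matrix ι ι ℝ
  | 0 => 1
  | n + 1 => A ((n : ℤ) + 1) * prodA A n

/-- The Lyapunov exponent `lim_n n⁻¹ log ‖B_n v‖` (as a `limsup`, in `EReal`). -/
noncomputable def lyap {ι : Type*} [Fintype ι] (B : ℕ → Matrix ι ι ℝ) (v : ι → ℝ) : EReal :=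
  Filter.limsup (fun n : ℕ => ((Real.log ‖B n *ᵥ v‖ / n : ℝ) : EReal)) Filter.atTop

/-- `V̄_0 = {v : lim_n n⁻¹ log ‖B_n v‖ ≤ 0}`. -/
def V0 {ι : Type*} [Fintype ι] (B : ℕ → Matrix ι ι ℝ) : Set (ι → ℝ) := {v | lyap B v ≤ 0}

/-- `V̄_{0-} = {v : lim_n n⁻¹ log ‖B_n v‖ < 0}`. -/
def V0minus {ι : Type*} [Fintype ι] (B : ℕ → Matrix ι ι ℝ) : Set (ι → ℝ) := {v | lyap B v < 0}

/-- `S` is a linear subspace of dimension `d`. -/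
def HasDim {ι : Type*} [Fintype ι] (S : Set (ι → ℝ)) (d : ℕ) : Prop :=
  ∃ W : Submodule ℝ (ι → ℝ), (W : Set (ι → ℝ)) = S ∧ Module.finrank ℝ W = d

/-- The `2m × 2m` matrix `A_i = [[M_i⁻¹, -σ_i],[I, 0]]` with `M_i = QΔ_i`, `N_i = Q(I - Δ_i)`,
`σ_i = M_i⁻¹ N_i`, where `p` lists the diagonal entries of `Δ_i`. -/
noncomputable def Afull {m : ℕ} (Q : Matrix (Fin m) (Fin m) ℝ) (p : Fin m → ℝ) :
    Matrix (Fin m ⊕ Fin m) (Fin m ⊕ Fin m) ℝ :=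
  Matrix.fromBlocks (Q * Matrix.diagonal p)⁻¹
    (-((Q * Matrix.diagonal p)⁻¹ * (Q * (1 - Matrix.diagonal p)))) 1 0

/-- `M̌_i = π⁽¹⁾Δ_i⁽¹⁾ + π⁽²⁾Δ_i⁽²⁾Θ`. -/
noncomputable def Mcheck {r s : ℕ} (π : Matrix (Fin r) (Fin r ⊕ Fin s) ℝ)
    (Θ : Matrix (Fin s) (Fin r) ℝ) (p : Fin r ⊕ Fin s → ℝ) : Matrix (Fin r) (Fin r) ℝ :=
  (Matrix.of fun a c => π a (Sum.inl c)) * Matrix.diagonal (fun c => p (Sum.inl c)) +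
    (Matrix.of fun a b => π a (Sum.inr b)) * Matrix.diagonal (fun b => p (Sum.inr b)) * Θ

/-- `Ň_i = π⁽¹⁾(I - Δ_i⁽¹⁾) + π⁽²⁾(I - Δ_i⁽²⁾)Θ`. -/
noncomputable def Ncheck {r s : ℕ} (π : Matrix (Fin r) (Fin r ⊕ Fin s) ℝ)
    (Θ : Matrix (Fin s) (Fin r) ℝ) (p : Fin r ⊕ Fin s → ℝ) : Matrix (Fin r) (Fin r) ℝ :=
  (Matrix.of fun a c => π a (Sum.inl c)) * (1 - Matrix.diagonal (fun c => p (Sum.inl c))) +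
    (Matrix.of fun a b => π a (Sum.inr b)) * (1 - Matrix.diagonal (fun b => p (Sum.inr b))) * Θ

/-- The `2r × 2r` matrix `Ǎ_i = [[M̌_i⁻¹, -σ̌_i],[I, 0]]` with `σ̌_i = M̌_i⁻¹ Ň_i`. -/
noncomputable def Acheck {r s : ℕ} (π : Matrix (Fin r) (Fin r ⊕ Fin s) ℝ)
    (Θ : Matrix (Fin s) (Fin r) ℝ) (p : Fin r ⊕ Fin s → ℝ) :
    Matrix (Fin r ⊕ Fin r) (Fin r ⊕ Fin r) ℝ :=
  Matrix.fromBlocks (Mcheck π Θ p)⁻¹ (-((Mcheck π Θ p)⁻¹ * Ncheck π Θ p)) 1 0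

/-- The event `{𝒩_ℓ ≥ k} = {τ_ℓ^{(k)} < ∞}`: there are at least `k` visits of `X` to `ℓ`
(at times `≥ 1`). -/
def visitsAtLeast {ι : Type*} (ℓ : ℤ) (k : ℕ) : Set (ℕ → ι × ℤ) :=
  {ω | ∃ s : Fin k → ℕ, StrictMono s ∧ ∀ j, 1 ≤ s j ∧ (ω (s j)).2 = ℓ}

/-- The event `{τ_ℓ^{(k+1)} < ∞, G_{τ_ℓ^{(k+1)}} = β}`: the walk visits `ℓ` at least `k+1` times
and the regime at the `(k+1)`-th visit is `β`. -/
def kthVisitInRegime {ι : Type*} (ℓ : ℤ) (k : ℕ) (β : ι) : Set (ℕ → ι × ℤ) :=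
  {ω | ∃ s : Fin (k + 1) → ℕ, StrictMono s ∧ (∀ j, 1 ≤ s j ∧ (ω (s j)).2 = ℓ) ∧
    (ω (s (Fin.last k))).1 = β ∧
    ∀ n : ℕ, 1 ≤ n → n ≤ s (Fin.last k) → (ω n).2 = ℓ → ∃ j, s j = n}

/-- The shift on real sequences. -/
def shiftSeq : (ℕ → ℝ) → (ℕ → ℝ) := fun x n => x (n + 1)

section Prefix

variable {S : Type*}

/-- The set of sequences agreeing with `c` up to time `n`. -/
def prefixCyl (n : ℕ) (c : ℕ → S) : Set (ℕ → S) := {ω | ∀ k ≤ n, ω k = c k}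

/-- The sequence stopped at time `n`. -/
def freeze (n : ℕ) (ω : ℕ → S) : ℕ → S := fun k => ω (min k n)

/-- The time shift by `n`. -/
def timeShift (n : ℕ) (ω : ℕ → S) : ℕ → S := fun k => ω (n + k)

/-- Membership in `F` only depends on the coordinates up to time `n`. -/
def DeterminedBy (n : ℕ) (F : Set (ℕ → S)) : Prop :=
  ∀ ω c : ℕ → S, ω ∈ prefixCyl n c → ω ∈ F → c ∈ F

theorem mem_prefixCyl_self (n : ℕ) (c : ℕ → S) : c ∈ prefixCyl n c := fun _ _ => rfl

theorem mem_prefixCyl_comm {n : ℕ} {ω c : ℕ → S} (h : ω ∈ prefixCyl n c) : c ∈ prefixCyl n ω :=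
  fun k hk => (h k hk).symm

theorem freeze_mem_prefixCyl (n : ℕ) (ω : ℕ → S) : freeze n ω ∈ prefixCyl n ω := fun k hk => by
  simp [freeze, min_eq_left hk]

theorem freeze_preimage_singleton (n : ℕ) (c : ℕ → S) :
    freeze n ⁻¹' {freeze n c} = prefixCyl n c := by
  ext ω
  constructor
  · intro h k hk
    have := congrFun (show freeze n ω = freeze n c from h) k
    simpa [freeze, min_eq_left hk] using this
  · intro h
    funext k
    exact h _ (min_le_right _ _)

theorem countable_range_freeze [Countable S] (n : ℕ) :
    (Set.range (freeze n : (ℕ → S) → ℕ → S)).Countable := by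
  let g : (Fin (n + 1) → S) → ℕ → S := fun v k => v ⟨min k n, by omega⟩
  refine (Set.countable_range g).mono ?_
  rintro _ ⟨ω, rfl⟩
  exact ⟨fun j => ω j, rfl⟩

variable [MeasurableSpace S]

theorem measurable_timeShift (n : ℕ) : Measurable (timeShift n : (ℕ → S) → ℕ → S) :=
  measurable_pi_lambda _ fun k => measurable_pi_apply (n + k)

variable [Countable S] [DiscreteMeasurableSpace S]

theorem measurableSet_prefixCyl (n : ℕ) (c : ℕ → S) : MeasurableSet (prefixCyl n c) := by
  have : prefixCyl n c = ⋂ k ∈ Finset.range (n + 1), (fun ω : ℕ → S => ω k) ⁻¹' {c k} := by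
    ext ω; simp [prefixCyl]
  rw [this]
  exact Finset.measurableSet_biInter _ fun k _ => measurable_pi_apply k (measurableSet_singleton _)

theorem DeterminedBy.measurableSet {n : ℕ} {F : Set (ℕ → S)} (hF : DeterminedBy n F) :
    MeasurableSet F := by
  have : F = ⋃ c ∈ F ∩ Set.range (freeze n), prefixCyl n c := by
    ext ω
    simp only [Set.mem_iUnion]
    constructor
    · intro h
      exact ⟨freeze n ω, ⟨hF _ _ (mem_prefixCyl_comm (freeze_mem_prefixCyl n ω)) h, ω, rfl⟩,
        mem_prefixCyl_comm (freeze_mem_prefixCyl n ω)⟩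
    · rintro ⟨c, ⟨hc, -⟩, h⟩
      exact hF _ _ (mem_prefixCyl_comm h) hc
  rw [this]
  exact MeasurableSet.biUnion ((countable_range_freeze n).mono Set.inter_subset_right)
    fun c _ => measurableSet_prefixCyl n c

theorem measure_univ_eq_tsum_prefixCyl (ν : Measure (ℕ → S)) (n : ℕ) :
    ν Set.univ = ∑' c : Set.range (freeze n : (ℕ → S) → ℕ → S), ν (prefixCyl n c) := by
  have h := tsum_measure_preimage_singleton (μ := ν)
    (countable_range_freeze (S := S) n) (f := freeze n) (by
      rintro _ ⟨c, rfl⟩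
      rw [freeze_preimage_singleton]
      exact measurableSet_prefixCyl n c)
  rw [Set.preimage_range] at h
  rw [← h]
  refine tsum_congr ?_
  rintro ⟨_, c, rfl⟩
  rw [freeze_preimage_singleton]
  congr 1
  rw [← freeze_preimage_singleton n (freeze n c), ← freeze_preimage_singleton]
  congr 2
  funext k
  simp [freeze]

theorem measure_univ_le_of_prefixCyl_le {ν₁ ν₂ : Measure (ℕ → S)} (n : ℕ)
    (h : ∀ c, ν₁ (prefixCyl n c) ≤ ν₂ (prefixCyl n c)) : ν₁ Set.univ ≤ ν₂ Set.univ := by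
  rw [measure_univ_eq_tsum_prefixCyl ν₁ n, measure_univ_eq_tsum_prefixCyl ν₂ n]
  exact ENNReal.tsum_le_tsum fun c => h c

/-- Finite measures on sequences agreeing on all prefix cylinders are equal. -/
theorem ext_of_prefixCyl {ν₁ ν₂ : Measure (ℕ → S)} [IsFiniteMeasure ν₁]
    (h : ∀ n c, ν₁ (prefixCyl n c) = ν₂ (prefixCyl n c)) : ν₁ = ν₂ := by
  have key : ∀ n, ν₂.map (Preorder.frestrictLe (π := fun _ => S) n) =
      ν₁.map (Preorder.frestrictLe (π := fun _ => S) n) := by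
    intro n
    refine Measure.ext_of_singleton fun v => ?_
    rw [Measure.map_apply (Preorder.measurable_frestrictLe n) (measurableSet_singleton _),
      Measure.map_apply (Preorder.measurable_frestrictLe n) (measurableSet_singleton _)]
    let c : ℕ → S := fun k => v ⟨min k n, by simp⟩
    have : Preorder.frestrictLe (π := fun _ => S) n ⁻¹' {v} = prefixCyl n c := by
      ext ω
      constructor
      · rintro rfl k hk
        simp [c, min_eq_left hk]
      · intro hω
        funext ⟨k, hk⟩
        have hk' : k ≤ n := by simpa using hk
        simpa [c, min_eq_left hk'] using hω k hk'
    rw [this, h]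
  have hP : IsProjectiveMeasureFamily (α := fun _ : ℕ => S)
      fun I : Finset ℕ => ν₁.map I.restrict := by
    intro I J hJI
    change ν₁.map J.restrict = (ν₁.map I.restrict).map (Finset.restrict₂ (π := fun _ => S) hJI)
    rw [Measure.map_map (Finset.measurable_restrict₂ (X := fun _ : ℕ => S) hJI)
      (Finset.measurable_restrict _)]
    rfl
  have h₁ : IsProjectiveLimit ν₁ fun I : Finset ℕ => ν₁.map I.restrict := fun _ => rfl
  have h₂ : IsProjectiveLimit ν₂ fun I : Finset ℕ => ν₁.map I.restrict :=
    (isProjectiveLimit_nat_iff hP ν₂).2 key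
  exact h₁.unique h₂

end Prefix

section MarkovFamily

variable {S : Type*}

/-- Sequences started at `s` whose first `n` steps have positive transition probability. -/
def posPath (K : S → S → ℝ) (s : S) (n : ℕ) : Set (ℕ → S) :=
  {ω | ω 0 = s ∧ ∀ k < n, 0 < K (ω k) (ω (k + 1))}

theorem determinedBy_posPath (K : S → S → ℝ) (s : S) (n : ℕ) :
    DeterminedBy n (posPath K s n) := by
  intro ω c h hω
  refine ⟨by rw [← h 0 (Nat.zero_le n)]; exact hω.1, fun k hk => ?_⟩
  rw [← h k hk.le, ← h (k + 1) hk]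
  exact hω.2 k hk

variable [MeasurableSpace S]

open Classical in
/-- `P s` is the law of the Markov chain with transition probabilities `K` started at `s`. -/
structure IsMarkovFamily (K : S → S → ℝ) (P : S → Measure (ℕ → S)) : Prop where
  nonneg : ∀ s t, 0 ≤ K s t
  isProb : ∀ s, IsProbabilityMeasure (P s)
  apply_prefixCyl : ∀ (s : S) (n : ℕ) (c : ℕ → S), P s (prefixCyl n c) =
    (if c 0 = s then 1 else 0) * ENNReal.ofReal (∏ k ∈ Finset.range n, K (c k) (c (k + 1)))

variable {K : S → S → ℝ} {P : S → Measure (ℕ → S)}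

namespace IsMarkovFamily

theorem prefixCyl_pos (hP : IsMarkovFamily K P) {s : S} {n : ℕ} {c : ℕ → S}
    (hc : c ∈ posPath K s n) : 0 < P s (prefixCyl n c) := by
  rw [hP.apply_prefixCyl, if_pos hc.1, one_mul, ENNReal.ofReal_pos]
  exact Finset.prod_pos fun k hk => hc.2 k (Finset.mem_range.1 hk)

variable [Countable S] [DiscreteMeasurableSpace S]

theorem ae_posPath (hP : IsMarkovFamily K P) (s : S) : ∀ᵐ ω ∂P s, ∀ n, ω ∈ posPath K s n := by
  rw [ae_all_iff]
  intro n
  have h := measure_univ_le_of_prefixCyl_le (ν₁ := (P s).restrict (posPath K s n)ᶜ) (ν₂ := 0) n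
    fun c => by
      rw [Measure.restrict_apply (measurableSet_prefixCyl n c)]
      simp only [Measure.coe_zero, Pi.zero_apply, nonpos_iff_eq_zero]
      by_cases hc : c ∈ posPath K s n
      · convert measure_empty (μ := P s)
        refine Set.eq_empty_of_forall_notMem fun ω hω => hω.2 ?_
        exact determinedBy_posPath K s n _ _ (mem_prefixCyl_comm hω.1) hc
      · refine measure_mono_null Set.inter_subset_left ?_
        rw [hP.apply_prefixCyl]
        by_cases h0 : c 0 = s
        · have : ∃ k < n, K (c k) (c (k + 1)) ≤ 0 := by
            by_contra! hcon
            exact hc ⟨h0, hcon⟩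
          obtain ⟨k, hk, hle⟩ := this
          rw [Finset.prod_eq_zero (Finset.mem_range.2 hk) (le_antisymm hle (hP.nonneg _ _))]
          simp
        · simp [h0]
  simpa [ae_iff, Set.compl_def] using h

/-- The image of a Markov family under an involution of the state space. -/
theorem map_involutive (hP : IsMarkovFamily K P) {r : S → S} (hr : Function.Involutive r) :
    IsMarkovFamily (fun s t => K (r s) (r t)) fun s => (P (r s)).map fun ω k => r (ω k) := by
  have hm : Measurable fun (ω : ℕ → S) k => r (ω k) :=
    measurable_pi_lambda _ fun k => Measurable.of_discrete.comp (measurable_pi_apply k)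
  have := hP.isProb
  refine ⟨fun s t => hP.nonneg _ _, fun s => Measure.isProbabilityMeasure_map hm.aemeasurable,
    fun s n c => ?_⟩
  have hpre : (fun (ω : ℕ → S) k => r (ω k)) ⁻¹' prefixCyl n c =
      prefixCyl n fun k => r (c k) := by
    ext ω
    exact forall₂_congr fun k _ => hr.eq_iff
  rw [Measure.map_apply hm (measurableSet_prefixCyl n c), hpre, hP.apply_prefixCyl]
  by_cases h : c 0 = s
  · simp [h]
  · simp [h, hr.injective.ne h]

/-- The Markov property at time `n`, on a prefix cylinder. -/
theorem prefixCyl_inter_shift (hP : IsMarkovFamily K P) (s : S) (n : ℕ) (c : ℕ → S)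
    {V : Set (ℕ → S)} (hV : MeasurableSet V) :
    P s (prefixCyl n c ∩ timeShift n ⁻¹' V) = P s (prefixCyl n c) * P (c n) V := by
  have := hP.isProb
  have hm := measurable_timeShift (S := S) n
  have key : ((P s).restrict (prefixCyl n c)).map (timeShift n) =
      P s (prefixCyl n c) • P (c n) := by
    refine ext_of_prefixCyl fun k d => ?_
    rw [Measure.map_apply hm (measurableSet_prefixCyl k d),
      Measure.restrict_apply (hm (measurableSet_prefixCyl k d)), Measure.smul_apply, smul_eq_mul,
      hP.apply_prefixCyl (c n)]
    by_cases h0 : d 0 = c n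
    · let e : ℕ → S := fun j => if j ≤ n then c j else d (j - n)
      have he : timeShift n ⁻¹' prefixCyl k d ∩ prefixCyl n c = prefixCyl (n + k) e := by
        ext ω
        constructor
        · rintro ⟨h₁, h₂⟩ j hj
          by_cases hjn : j ≤ n
          · simpa [e, hjn] using h₂ j hjn
          · have := h₁ (j - n) (by omega)
            simpa [e, hjn, timeShift, Nat.add_sub_cancel' (le_of_not_ge hjn)] using this
        · intro h
          refine ⟨fun j hj => ?_, fun j hj => ?_⟩
          · have := h (n + j) (by omega)
            rcases Nat.eq_zero_or_pos j with rfl | hj0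
            · simpa [timeShift, e, h0] using this
            · simpa [timeShift, e, hj0.ne'] using this
          · simpa [e, hj] using h j (by omega)
      rw [he, hP.apply_prefixCyl, hP.apply_prefixCyl, if_pos h0, one_mul, mul_assoc,
        ← ENNReal.ofReal_mul (Finset.prod_nonneg fun _ _ => hP.nonneg _ _), Finset.prod_range_add]
      congr 2
      congr 1
      · refine Finset.prod_congr rfl fun j hj => ?_
        have hj := Finset.mem_range.1 hj
        simp [e, hj.le, Nat.succ_le_of_lt hj]
      · refine Finset.prod_congr rfl fun j _ => ?_
        have h1 : e (n + j) = d j := by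
          rcases Nat.eq_zero_or_pos j with rfl | hj0
          · simp [e, h0]
          · simp [e, hj0.ne']
        have h2 : e (n + j + 1) = d (j + 1) := by
          simp only [e]
          rw [if_neg (by omega)]
          congr 1
          omega
        rw [h1, h2]
    · rw [if_neg h0, zero_mul, mul_zero]
      convert measure_empty (μ := P s)
      refine Set.eq_empty_of_forall_notMem fun ω hω => h0 ?_
      rw [← hω.1 0 (Nat.zero_le k), ← hω.2 n le_rfl]
      rfl
  have h := congrArg (fun ν => ν V) key
  simp only [Measure.map_apply hm hV, Measure.restrict_apply (hm hV), Measure.smul_apply,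
    smul_eq_mul] at h
  rw [Set.inter_comm, h]

theorem inter_shift_le (hP : IsMarkovFamily K P) (s : S) {n : ℕ} {F V : Set (ℕ → S)}
    (hF : DeterminedBy n F) (hV : MeasurableSet V) {u : ℝ≥0∞}
    (hu : ∀ ω ∈ F, P (ω n) V ≤ u) : P s (F ∩ timeShift n ⁻¹' V) ≤ P s F * u := by
  have h := measure_univ_le_of_prefixCyl_le
    (ν₁ := (P s).restrict (F ∩ timeShift n ⁻¹' V)) (ν₂ := u • (P s).restrict F) n fun c => by
      rw [Measure.smul_apply, Measure.restrict_apply (measurableSet_prefixCyl n c),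
        Measure.restrict_apply (measurableSet_prefixCyl n c), smul_eq_mul]
      by_cases hc : c ∈ F
      · have hsub : prefixCyl n c ⊆ F := fun ω hω => hF _ _ (mem_prefixCyl_comm hω) hc
        rw [← Set.inter_assoc, Set.inter_eq_left.2 hsub, hP.prefixCyl_inter_shift s n c hV,
          mul_comm]
        gcongr
        exact hu c hc
      · have : prefixCyl n c ∩ (F ∩ timeShift n ⁻¹' V) = ∅ :=
          Set.eq_empty_of_forall_notMem fun ω hω => hc (hF _ _ hω.1 hω.2.1)
        rw [this]
        simp
  simpa [mul_comm] using h

/-- If `V` has probability at most `u` from every state occupied at the stopping time described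
by the disjoint events `F n`, then the event that `V` occurs after that time has probability at
most `u` times the probability that the time is finite. -/
theorem strong_markov_le (hP : IsMarkovFamily K P) (s : S) {F : ℕ → Set (ℕ → S)}
    {V : Set (ℕ → S)} (hF : ∀ n, DeterminedBy n (F n))
    (hdisj : Pairwise (Function.onFun Disjoint F)) (hV : MeasurableSet V)
    (hsub : V ⊆ ⋃ n, F n ∩ timeShift n ⁻¹' V) {u : ℝ≥0∞}
    (hu : ∀ n, ∀ ω ∈ F n, P (ω n) V ≤ u) : P s V ≤ P s (⋃ n, F n) * u := by
  calc P s V ≤ ∑' n, P s (F n ∩ timeShift n ⁻¹' V) :=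
        (measure_mono hsub).trans (measure_iUnion_le _)
    _ ≤ ∑' n, P s (F n) * u := ENNReal.tsum_le_tsum fun n => hP.inter_shift_le s (hF n) hV (hu n)
    _ = P s (⋃ n, F n) * u := by
        rw [ENNReal.tsum_mul_right, measure_iUnion hdisj fun n => (hF n).measurableSet]

theorem eq_zero_of_regeneration (hP : IsMarkovFamily K P) {L : Set S} (hL : L.Finite)
    {F : ℕ → Set (ℕ → S)} {V : Set (ℕ → S)} (hF : ∀ n, DeterminedBy n (F n))
    (hdisj : Pairwise (Function.onFun Disjoint F)) (hV : MeasurableSet V)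
    (hsub : V ⊆ ⋃ n, F n ∩ timeShift n ⁻¹' V) (hFL : ∀ n, ∀ ω ∈ F n, ω n ∈ L)
    (hlt : ∀ t ∈ L, P t (⋃ n, F n) < 1) (s : S) : P s V = 0 := by
  have := hP.isProb
  have hzero : ∀ t ∈ L, P t V = 0 := by
    rcases L.eq_empty_or_nonempty with rfl | hne
    · simp
    obtain ⟨t₀, ht₀, hmax⟩ := hL.exists_maximalFor (fun t => P t V) L hne
    have hmax' : ∀ t ∈ L, P t V ≤ P t₀ V := fun t ht =>
      (le_total (P t V) (P t₀ V)).elim id fun h => hmax ht h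
    have h₁ := hP.strong_markov_le t₀ hF hdisj hV hsub (u := P t₀ V)
      fun n ω hω => hmax' _ (hFL n ω hω)
    have h₂ : P t₀ V = 0 := by
      by_contra h0
      have := ENNReal.mul_lt_mul_left h0 (measure_ne_top _ _) (hlt t₀ ht₀)
      rw [one_mul] at this
      exact absurd h₁ (not_le.2 this)
    exact fun t ht => le_antisymm (h₂ ▸ hmax' t ht) zero_le
  have := hP.strong_markov_le s hF hdisj hV hsub (u := 0)
    fun n ω hω => (hzero _ (hFL n ω hω)).le
  simpa using this

end IsMarkovFamily

end MarkovFamily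

section NearestNeighbour

variable {x : ℕ → ℤ}

theorem exists_eq_of_le_of_le (hx : ∀ n, x (n + 1) = x n + 1 ∨ x (n + 1) = x n - 1) {a b : ℕ}
    (hab : a ≤ b) {ℓ : ℤ} (ha : x a ≤ ℓ) (hb : ℓ ≤ x b) : ∃ c, a ≤ c ∧ c ≤ b ∧ x c = ℓ := by
  induction b, hab using Nat.le_induction with
  | base => exact ⟨a, le_rfl, le_rfl, le_antisymm ha hb⟩
  | succ b hab ih =>
    by_cases h : ℓ ≤ x b
    · obtain ⟨c, h₁, h₂, h₃⟩ := ih h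
      exact ⟨c, h₁, h₂.trans (Nat.le_succ b), h₃⟩
    · refine ⟨b + 1, by omega, le_rfl, ?_⟩
      rcases hx b with h' | h' <;> omega

theorem exists_eq_of_ge_of_ge (hx : ∀ n, x (n + 1) = x n + 1 ∨ x (n + 1) = x n - 1) {a b : ℕ}
    (hab : a ≤ b) {ℓ : ℤ} (ha : ℓ ≤ x a) (hb : x b ≤ ℓ) : ∃ c, a ≤ c ∧ c ≤ b ∧ x c = ℓ := by
  obtain ⟨c, h₁, h₂, h₃⟩ := exists_eq_of_le_of_le (x := fun n => -x n) (ℓ := -ℓ)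
    (fun n => by rcases hx n with h | h <;> simp only [h] <;> omega) hab (by omega) (by omega)
  exact ⟨c, h₁, h₂, by simpa using h₃⟩

theorem le_add_of_nearestNeighbour (hx : ∀ n, x (n + 1) = x n + 1 ∨ x (n + 1) = x n - 1) (n : ℕ) :
    x n ≤ x 0 + n := by
  induction n with
  | zero => simp
  | succ n ih => rcases hx n with h | h <;> push_cast <;> omega

theorem tendsto_atTop_of_hits (hx : ∀ n, x (n + 1) = x n + 1 ∨ x (n + 1) = x n - 1)
    (htrans : ∀ ℓ, ¬∃ᶠ n in atTop, x n = ℓ) (hhit : ∀ ℓ, x 0 < ℓ → ∃ n, x n = ℓ) :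
    Tendsto x atTop atTop := by
  rw [tendsto_atTop]
  intro M
  obtain ⟨N, hN⟩ := eventually_atTop.1 (not_frequently.1 (htrans (max M (x 0))))
  obtain ⟨n, hn⟩ := hhit (max M (x 0) + N + 1) (by have := le_max_right M (x 0); omega)
  have hle := le_add_of_nearestNeighbour hx n
  have hmax := le_max_right M (x 0)
  have hNn : N ≤ n := by omega
  refine eventually_atTop.2 ⟨n, fun k hk => ?_⟩
  by_contra! hlt
  obtain ⟨c, h₁, -, h₃⟩ := exists_eq_of_ge_of_ge hx hk (ℓ := max M (x 0)) (by omega)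
    (hlt.le.trans (le_max_left _ _))
  exact hN c (hNn.trans h₁) h₃

end NearestNeighbour

section Step

variable {ι : Type*} {Q : Matrix ι ι ℝ} {p : ι → ℤ → ℝ}

theorem step_nonneg (hQ0 : ∀ α β, 0 ≤ Q α β) (hp : ∀ α k, p α k ∈ Set.Ioo (0 : ℝ) 1)
    (s t : ι × ℤ) : 0 ≤ step Q p s t := by
  have := hp t.1 s.2
  refine mul_nonneg (hQ0 _ _) ?_
  split_ifs
  · exact this.1.le
  · linarith [this.2]
  · exact le_rfl

theorem step_pos_iff (hp : ∀ α k, p α k ∈ Set.Ioo (0 : ℝ) 1)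
    (s t : ι × ℤ) : 0 < step Q p s t ↔ 0 < Q s.1 t.1 ∧ (t.2 = s.2 + 1 ∨ t.2 = s.2 - 1) := by
  have h1 := hp t.1 s.2
  unfold step
  split_ifs with h h'
  · simp [h, h1.1]
  · simp [h', h1.2]
  · simp [h, h']

theorem nearestNeighbour_of_posPath (hp : ∀ α k, p α k ∈ Set.Ioo (0 : ℝ) 1) {s : ι × ℤ}
    {ω : ℕ → ι × ℤ} (hω : ∀ n, ω ∈ posPath (step Q p) s n) (n : ℕ) :
    (ω (n + 1)).2 = (ω n).2 + 1 ∨ (ω (n + 1)).2 = (ω n).2 - 1 :=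
  ((step_pos_iff hp _ _).1 ((hω (n + 1)).2 n n.lt_succ_self)).2

theorem exists_pos_of_sum_eq_one [Fintype ι] (hQ1 : ∀ α, ∑ β, Q α β = 1) (α : ι) :
    ∃ β, 0 < Q α β := by
  by_contra! h
  linarith [hQ1 α, Finset.sum_nonpos fun β (_ : β ∈ Finset.univ) => h β]

/-- Reflecting a path at the level above `ℓ` keeps it admissible, and above `ℓ`. -/
theorem reflect_mem_posPath (hp : ∀ α k, p α k ∈ Set.Ioo (0 : ℝ) 1) {s : ι × ℤ} {ℓ : ℤ}
    (hs : ℓ < s.2) {n : ℕ} {ω : ℕ → ι × ℤ} (hω : ω ∈ posPath (step Q p) s n) :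
    (fun k => ((ω k).1, ℓ + 1 + |(ω k).2 - (ℓ + 1)|)) ∈ posPath (step Q p) s n := by
  obtain ⟨h0, hpos⟩ := hω
  refine ⟨?_, fun k hk => ?_⟩
  · dsimp only
    rw [h0, abs_of_nonneg (by omega)]
    ext <;> simp
  · have h := (step_pos_iff hp _ _).1 (hpos k hk)
    refine (step_pos_iff hp _ _).2 ⟨h.1, ?_⟩
    dsimp only
    have h2 := h.2
    rcases abs_cases ((ω k).2 - (ℓ + 1)) with ⟨e₁, _⟩ | ⟨e₁, _⟩ <;>
    rcases abs_cases ((ω (k + 1)).2 - (ℓ + 1)) with ⟨e₂, _⟩ | ⟨e₂, _⟩ <;>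
    rw [e₁, e₂] <;> omega

theorem IsQuenchedLaw.isMarkovFamily [DecidableEq ι] [MeasurableSpace ι]
    {μ : ι → ℤ → Measure (ℕ → ι × ℤ)}
    (hμ : IsQuenchedLaw Q p μ) (hQ0 : ∀ α β, 0 ≤ Q α β)
    (hp : ∀ α k, p α k ∈ Set.Ioo (0 : ℝ) 1) :
    IsMarkovFamily (step Q p) fun s => μ s.1 s.2 where
  nonneg := step_nonneg hQ0 hp
  isProb s := (hμ s.1 s.2).1
  apply_prefixCyl s n c := by
    convert (hμ s.1 s.2).2 n c using 1
    rw [prefixCyl]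
    congr

end Step

section Walk

variable {ι : Type*}

/-- The walk visits level `ℓ` at time `n ≥ 1`, without having visited `D` at earlier times
`≥ 1`. -/
def returnAvoiding (ℓ : ℤ) (D : Set ℤ) (n : ℕ) : Set (ℕ → ι × ℤ) :=
  {ω | 1 ≤ n ∧ (ω n).2 = ℓ ∧ ∀ k, 1 ≤ k → k < n → (ω k).2 ∉ D}

theorem determinedBy_returnAvoiding (ℓ : ℤ) (D : Set ℤ) (n : ℕ) :
    DeterminedBy n (returnAvoiding ℓ D n : Set (ℕ → ι × ℤ)) := by
  rintro ω c h ⟨h₁, h₂, h₃⟩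
  refine ⟨h₁, by rw [← h n le_rfl]; exact h₂, fun k hk hkn => ?_⟩
  rw [← h k hkn.le]
  exact h₃ k hk hkn

theorem disjoint_returnAvoiding {ℓ : ℤ} {D : Set ℤ} (hD : ℓ ∈ D) :
    Pairwise (Function.onFun Disjoint (returnAvoiding ℓ D : ℕ → Set (ℕ → ι × ℤ))) := by
  have key : ∀ a b, a < b → ∀ ω : ℕ → ι × ℤ, ω ∈ returnAvoiding ℓ D a →
      ω ∉ returnAvoiding ℓ D b := fun a b hab ω ha hb =>
    hb.2.2 a ha.1 hab (ha.2.1 ▸ hD)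
  intro a b hab
  refine Set.disjoint_left.2 fun ω ha hb => ?_
  rcases lt_or_gt_of_ne hab with h | h
  · exact key a b h ω ha hb
  · exact key b a h ω hb ha

/-- The walk visits level `ℓ` infinitely often and never visits `A` at times `≥ 1`. -/
def frequentlyAvoiding (ℓ : ℤ) (A : Set ℤ) : Set (ℕ → ι × ℤ) :=
  {ω | (∃ᶠ n in atTop, (ω n).2 = ℓ) ∧ ∀ n, 1 ≤ n → (ω n).2 ∉ A}

theorem frequentlyAvoiding_subset (ℓ : ℤ) (A : Set ℤ) :
    (frequentlyAvoiding ℓ A : Set (ℕ → ι × ℤ)) ⊆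
      ⋃ n, returnAvoiding ℓ (insert ℓ A) n ∩ timeShift n ⁻¹' frequentlyAvoiding ℓ A := by
  classical
  rintro ω ⟨h₁, h₂⟩
  have hex : ∃ n, 1 ≤ n ∧ (ω n).2 = ℓ := frequently_atTop.1 h₁ 1
  have hmin := fun k => Nat.find_min hex (m := k)
  obtain ⟨hn, hnℓ⟩ := Nat.find_spec hex
  refine Set.mem_iUnion.2 ⟨Nat.find hex, ⟨hn, hnℓ, fun k hk hkn => ?_⟩, ?_, fun k hk => ?_⟩
  · rintro (h | h)
    · exact hmin k hkn ⟨hk, h⟩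
    · exact h₂ k hk h
  · rw [frequently_atTop] at h₁ ⊢
    intro a
    obtain ⟨b, hb, hbℓ⟩ := h₁ (Nat.find hex + a)
    refine ⟨b - Nat.find hex, by omega, ?_⟩
    rw [timeShift, Nat.add_sub_cancel' (by omega)]
    exact hbℓ
  · exact h₂ _ (by omega)

variable [MeasurableSpace ι]

theorem measurableSet_hitEvent (ℓ : ℤ) : MeasurableSet (hitEvent ℓ : Set (ℕ → ι × ℤ)) := by
  unfold hitEvent
  measurability

theorem measurableSet_driftTop : MeasurableSet (driftTop : Set (ℕ → ι × ℤ)) := by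
  simp only [driftTop, tendsto_atTop_atTop]
  measurability

theorem measurableSet_driftBot : MeasurableSet (driftBot : Set (ℕ → ι × ℤ)) := by
  simp only [driftBot, tendsto_atTop_atBot]
  measurability

theorem measurableSet_oscillate : MeasurableSet (oscillate : Set (ℕ → ι × ℤ)) := by
  simp only [oscillate, frequently_atTop]
  measurability

theorem measurableSet_frequently_eq (ℓ : ℤ) :
    MeasurableSet {ω : ℕ → ι × ℤ | ∃ᶠ n in atTop, (ω n).2 = ℓ} := by
  simp only [frequently_atTop]
  measurability

theorem measurableSet_frequentlyAvoiding (ℓ : ℤ) (A : Set ℤ) :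
    MeasurableSet (frequentlyAvoiding ℓ A : Set (ℕ → ι × ℤ)) := by
  have : MeasurableSet {ω : ℕ → ι × ℤ | ∀ n, 1 ≤ n → (ω n).2 ∉ A} := by
    simp only [Set.ofPred_forall]
    exact .iInter fun n => .iInter fun _ =>
      ((measurable_pi_apply n).snd (.of_discrete : MeasurableSet A)).compl
  exact (measurableSet_frequently_eq ℓ).inter this

variable [Finite ι] [DiscreteMeasurableSpace ι] {K : ι × ℤ → ι × ℤ → ℝ}
  {P : ι × ℤ → Measure (ℕ → ι × ℤ)}

namespace IsMarkovFamily

theorem frequentlyAvoiding_eq_zero (hP : IsMarkovFamily K P) (ℓ : ℤ) (A : Set ℤ)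
    (hlt : ∀ α : ι, P (α, ℓ) (⋃ n, returnAvoiding ℓ (insert ℓ A) n) < 1) (s : ι × ℤ) :
    P s (frequentlyAvoiding ℓ A) = 0 := by
  refine hP.eq_zero_of_regeneration (L := Set.univ ×ˢ {ℓ})
    (Set.finite_univ.prod (Set.finite_singleton ℓ))
    (determinedBy_returnAvoiding ℓ (insert ℓ A)) (disjoint_returnAvoiding (Set.mem_insert ℓ A))
    (measurableSet_frequentlyAvoiding ℓ A) (frequentlyAvoiding_subset ℓ A)
    (fun n ω hω => ⟨Set.mem_univ _, hω.2.1⟩) ?_ s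
  rintro ⟨α, i⟩ ⟨-, rfl : i = ℓ⟩
  exact hlt α

/-- A walk that almost surely returns to level `ℓ` from level `ℓ` visits it infinitely often as
soon as it visits it. -/
theorem ae_frequently_of_return (hP : IsMarkovFamily K P) (ℓ : ℤ)
    (hret : ∀ α : ι, P (α, ℓ) (hitEvent ℓ) = 1) (s : ι × ℤ) :
    ∀ᵐ ω ∂P s, ∀ n, (ω n).2 = ℓ → ∃ᶠ k in atTop, (ω k).2 = ℓ := by
  have := hP.isProb
  have h : ∀ᵐ ω ∂P s, ∀ n, (ω n).2 = ℓ → timeShift n ω ∈ hitEvent ℓ := by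
    rw [ae_all_iff]
    intro n
    have h := hP.inter_shift_le s (n := n) (F := {ω | (ω n).2 = ℓ}) (V := (hitEvent ℓ)ᶜ) (u := 0)
      (fun ω c h hω => by
        change (c n).2 = ℓ
        rw [← h n le_rfl]
        exact hω)
      (measurableSet_hitEvent ℓ).compl
      (fun ω hω => by
        rw [← show (ω n).2 = ℓ from hω] at hret ⊢
        exact ((prob_compl_eq_zero_iff (measurableSet_hitEvent _)).2 (hret _)).le)
    rw [mul_zero, nonpos_iff_eq_zero] at h
    rw [ae_iff]
    convert h using 2
    ext ω
    simp
  filter_upwards [h] with ω hω n hn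
  rw [frequently_atTop]
  intro a
  induction a with
  | zero => exact ⟨n, Nat.zero_le n, hn⟩
  | succ a ih =>
    obtain ⟨b, hb, hbℓ⟩ := ih
    obtain ⟨k, hk, hkℓ⟩ := hω b hbℓ
    exact ⟨b + k, by omega, hkℓ⟩

theorem apply_lt_one (hP : IsMarkovFamily K P) {s : ι × ℤ} {n : ℕ} {c : ℕ → ι × ℤ}
    (hc : c ∈ posPath K s n) {A : Set (ℕ → ι × ℤ)} (hA : Disjoint A (prefixCyl n c)) :
    P s A < 1 := by
  have := hP.isProb
  calc P s A ≤ P s (prefixCyl n c)ᶜ := measure_mono hA.subset_compl_right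
    _ = 1 - P s (prefixCyl n c) := prob_compl_eq_one_sub (measurableSet_prefixCyl n c)
    _ < 1 := ENNReal.sub_lt_self ENNReal.one_ne_top one_ne_zero (hP.prefixCyl_pos hc).ne'

end IsMarkovFamily

end Walk

section Dichotomy

variable {ι : Type*} [Fintype ι] [MeasurableSpace ι] [DiscreteMeasurableSpace ι]
  {Q : Matrix ι ι ℝ} {p : ι → ℤ → ℝ} {P : ι × ℤ → Measure (ℕ → ι × ℤ)}

theorem apply_hitEvent_compl_eq_zero (hP : IsMarkovFamily (step Q p) P)
    (hp : ∀ α k, p α k ∈ Set.Ioo (0 : ℝ) 1) {s : ι × ℤ} {ℓ : ℤ} (hs : ℓ < s.2)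
    (h1 : P s (hitEvent ℓ) = 1) {n : ℕ} {ω : ℕ → ι × ℤ} (hω : ω ∈ posPath (step Q p) s n)
    (hn : ℓ < (ω n).2) : P (ω n) (hitEvent ℓ)ᶜ = 0 := by
  have := hP.isProb
  set c : ℕ → ι × ℤ := fun k => ((ω k).1, ℓ + 1 + |(ω k).2 - (ℓ + 1)|) with hc
  have hcpos := reflect_mem_posPath hp hs hω
  have hcn : c n = ω n := by
    simp only [hc]
    rw [abs_of_nonneg (by omega)]
    ext <;> simp
  have hsub : prefixCyl n c ∩ timeShift n ⁻¹' (hitEvent ℓ)ᶜ ⊆ (hitEvent ℓ)ᶜ := by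
    rintro η ⟨h₁, h₂⟩ ⟨k, hk, hkℓ⟩
    by_cases hkn : k ≤ n
    · have := congrArg Prod.snd (h₁ k hkn)
      have habs := abs_nonneg ((ω k).2 - (ℓ + 1))
      simp only [hc] at this
      omega
    · refine h₂ ⟨k - n, by omega, ?_⟩
      rw [timeShift, Nat.add_sub_cancel' (by omega)]
      exact hkℓ
  have hnull := measure_mono_null hsub ((prob_compl_eq_zero_iff (measurableSet_hitEvent ℓ)).2 h1)
  rw [hP.prefixCyl_inter_shift s n c (measurableSet_hitEvent ℓ).compl, hcn] at hnull
  exact (mul_eq_zero.1 hnull).resolve_left (hP.prefixCyl_pos hcpos).ne'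

theorem hitEvent_lt_one_of_driftTop (hP : IsMarkovFamily (step Q p) P)
    (hp : ∀ α k, p α k ∈ Set.Ioo (0 : ℝ) 1) {s : ι × ℤ} (hdrift : P s driftTop = 1) {ℓ : ℤ}
    (hs : ℓ < s.2) : P s (hitEvent ℓ) < 1 := by
  have := hP.isProb
  refine lt_of_le_of_ne prob_le_one fun h1 => ?_
  have hhit : ∀ᵐ ω ∂P s, ∀ n, ω ∈ posPath (step Q p) s n → ℓ < (ω n).2 →
      timeShift n ω ∈ hitEvent ℓ := by
    rw [ae_all_iff]
    intro n
    have h := hP.inter_shift_le s (n := n) (F := posPath (step Q p) s n ∩ {ω | ℓ < (ω n).2})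
      (V := (hitEvent ℓ)ᶜ) (u := 0)
      (fun ω c h hω => ⟨determinedBy_posPath _ _ _ _ _ h hω.1, by
        change ℓ < (c n).2
        rw [← h n le_rfl]
        exact hω.2⟩)
      (measurableSet_hitEvent ℓ).compl
      (fun ω hω => (apply_hitEvent_compl_eq_zero hP hp hs h1 hω.1 hω.2).le)
    rw [mul_zero, nonpos_iff_eq_zero] at h
    rw [ae_iff]
    convert h using 2
    ext ω
    simp only [Classical.not_imp, Set.mem_inter_iff, Set.mem_preimage, Set.mem_compl_iff, and_assoc]
    rfl
  have hd : ∀ᵐ ω ∂P s, ω ∈ driftTop := (mem_ae_iff_prob_eq_one measurableSet_driftTop).2 hdrift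
  obtain ⟨ω, h₁, h₂, h₃⟩ := (hhit.and (hd.and (hP.ae_posPath s))).exists
  obtain ⟨N, hN⟩ := eventually_atTop.1 ((tendsto_atTop.1 h₂) (ℓ + 1))
  obtain ⟨k, -, hkℓ⟩ := h₁ N (h₃ N) (by have := hN N le_rfl; omega)
  have := hN (N + k) (by omega)
  change (ω (N + k)).2 = ℓ at hkℓ
  omega

theorem hitEvent_eq_one_of_driftTop (hP : IsMarkovFamily (step Q p) P)
    (hp : ∀ α k, p α k ∈ Set.Ioo (0 : ℝ) 1) {s : ι × ℤ} (hdrift : P s driftTop = 1) {ℓ : ℤ}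
    (hs : s.2 < ℓ) : P s (hitEvent ℓ) = 1 := by
  have := hP.isProb
  have hd : ∀ᵐ ω ∂P s, ω ∈ driftTop := (mem_ae_iff_prob_eq_one measurableSet_driftTop).2 hdrift
  refine (mem_ae_iff_prob_eq_one (measurableSet_hitEvent ℓ)).1 ?_
  filter_upwards [hd, hP.ae_posPath s] with ω h₁ h₂
  obtain ⟨N, hN⟩ := eventually_atTop.1 ((tendsto_atTop.1 h₁) ℓ)
  have h0 : (ω 0).2 = s.2 := by rw [(h₂ 0).1]
  obtain ⟨c, -, -, hc⟩ := exists_eq_of_le_of_le (x := fun n => (ω n).2)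
    (nearestNeighbour_of_posPath hp h₂)
    (Nat.zero_le N) (h0.trans_le hs.le) (hN N le_rfl)
  refine ⟨c, Nat.one_le_iff_ne_zero.2 ?_, hc⟩
  rintro rfl
  omega

theorem return_lt_one (hP : IsMarkovFamily (step Q p) P) (hQ1 : ∀ α, ∑ β, Q α β = 1)
    (hp : ∀ α k, p α k ∈ Set.Ioo (0 : ℝ) 1) (ℓ : ℤ)
    (hlt : ∀ α, P (α, ℓ + 1) (hitEvent ℓ) < 1) (α : ι) : P (α, ℓ) (hitEvent ℓ) < 1 := by
  have := hP.isProb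
  obtain ⟨β, hβ⟩ := exists_pos_of_sum_eq_one hQ1 α
  let c : ℕ → ι × ℤ := fun k => if k = 0 then (α, ℓ) else (β, ℓ + 1)
  have hc : c ∈ posPath (step Q p) (α, ℓ) 1 := by
    refine ⟨rfl, fun k hk => ?_⟩
    obtain rfl : k = 0 := by omega
    exact (step_pos_iff hp _ _).2 ⟨hβ, Or.inl rfl⟩
  have hsub : prefixCyl 1 c ∩ timeShift 1 ⁻¹' (hitEvent ℓ)ᶜ ⊆ (hitEvent ℓ)ᶜ := by
    rintro η ⟨h₁, h₂⟩ ⟨k, hk, hkℓ⟩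
    rcases hk.eq_or_lt with rfl | hk1
    · have := congrArg Prod.snd (h₁ 1 le_rfl)
      simp only [c, one_ne_zero, if_false] at this
      omega
    · refine h₂ ⟨k - 1, by omega, ?_⟩
      rw [timeShift, Nat.add_sub_cancel' (by omega)]
      exact hkℓ
  refine lt_of_le_of_ne prob_le_one fun h1 => ?_
  have hnull := measure_mono_null hsub ((prob_compl_eq_zero_iff (measurableSet_hitEvent ℓ)).2 h1)
  rw [hP.prefixCyl_inter_shift _ 1 c (measurableSet_hitEvent ℓ).compl] at hnull
  have h0 := (mul_eq_zero.1 hnull).resolve_left (hP.prefixCyl_pos hc).ne'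
  exact (hlt β).ne ((prob_compl_eq_zero_iff (measurableSet_hitEvent ℓ)).1 h0)

theorem driftTop_eq_one_iff (hP : IsMarkovFamily (step Q p) P) (hQ1 : ∀ α, ∑ β, Q α β = 1)
    (hp : ∀ α k, p α k ∈ Set.Ioo (0 : ℝ) 1) :
    (∀ s, P s driftTop = 1) ↔ ∀ (s : ι × ℤ) (ℓ : ℤ),
      (s.2 < ℓ → P s (hitEvent ℓ) = 1) ∧ (ℓ < s.2 → P s (hitEvent ℓ) < 1) := by
  have := hP.isProb
  refine ⟨fun h s ℓ => ⟨hitEvent_eq_one_of_driftTop hP hp (h s),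
    hitEvent_lt_one_of_driftTop hP hp (h s)⟩, fun h s => ?_⟩
  have htrans : ∀ᵐ ω ∂P s, ∀ ℓ : ℤ, ¬∃ᶠ n in atTop, (ω n).2 = ℓ := by
    rw [ae_all_iff]
    intro ℓ
    have h0 := hP.frequentlyAvoiding_eq_zero ℓ ∅ (fun α => lt_of_le_of_lt
      (measure_mono (t := hitEvent ℓ) (Set.iUnion_subset fun n ω hω => ⟨n, hω.1, hω.2.1⟩))
      (return_lt_one hP hQ1 hp ℓ (fun β => (h (β, ℓ + 1) ℓ).2 (by simp)) α)) s
    rw [ae_iff]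
    convert h0 using 2
    ext ω
    change ¬¬_ ↔ _
    simp only [not_not, frequentlyAvoiding, Set.mem_empty_iff_false, not_false_eq_true,
      implies_true, and_true]
    rfl
  have hhit : ∀ᵐ ω ∂P s, ∀ ℓ : ℤ, s.2 < ℓ → ω ∈ hitEvent ℓ := by
    rw [ae_all_iff]
    intro ℓ
    by_cases hℓ : s.2 < ℓ
    · filter_upwards [(mem_ae_iff_prob_eq_one (measurableSet_hitEvent ℓ)).2 ((h s ℓ).1 hℓ)]
        with ω hω _ using hω
    · exact Eventually.of_forall fun _ h => absurd h hℓ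
  refine (mem_ae_iff_prob_eq_one measurableSet_driftTop).1 ?_
  filter_upwards [htrans, hhit, hP.ae_posPath s] with ω h₁ h₂ h₃
  refine tendsto_atTop_of_hits (nearestNeighbour_of_posPath hp h₃) h₁ fun ℓ hℓ => ?_
  obtain ⟨n, -, hn⟩ := h₂ ℓ (by rwa [(h₃ 0).1] at hℓ)
  exact ⟨n, hn⟩

theorem returnAvoiding_lt_one (hP : IsMarkovFamily (step Q p) P) (hQ1 : ∀ α, ∑ β, Q α β = 1)
    (hp : ∀ α k, p α k ∈ Set.Ioo (0 : ℝ) 1) {i M : ℤ} (hM : M ≠ i) (α : ι) :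
    P (α, i) (⋃ n, returnAvoiding i {i, M} n) < 1 := by
  choose g hg using exists_pos_of_sum_eq_one hQ1
  obtain ⟨ε, hε, d, hd⟩ : ∃ ε : ℤ, (ε = 1 ∨ ε = -1) ∧ ∃ d : ℕ, M = i + ε * d := by
    rcases le_total i M with h | h
    · exact ⟨1, Or.inl rfl, (M - i).toNat, by omega⟩
    · exact ⟨-1, Or.inr rfl, (i - M).toNat, by omega⟩
  let c : ℕ → ι × ℤ := fun k => (g^[k] α, i + ε * k)
  have hc : c ∈ posPath (step Q p) (α, i) d := by
    refine ⟨by simp [c], fun k _ => (step_pos_iff hp _ _).2 ⟨?_, ?_⟩⟩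
    · simp only [c, Function.iterate_succ_apply']
      exact hg _
    · simp only [c]
      rcases hε with rfl | rfl <;> push_cast <;> omega
  refine hP.apply_lt_one hc (Set.disjoint_left.2 fun ω hω hωc => ?_)
  obtain ⟨n, hn, hni, hav⟩ := Set.mem_iUnion.1 hω
  have hd1 : 1 ≤ d := Nat.one_le_iff_ne_zero.2 (by rintro rfl; simp at hd; exact hM hd)
  by_cases hnd : n ≤ d
  · have := congrArg Prod.snd (hωc n hnd)
    simp only [c] at this
    rcases hε with rfl | rfl <;> omega
  · refine hav d hd1 (by omega) (Or.inr ?_)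
    rw [hωc d le_rfl, Set.mem_singleton_iff, hd]

theorem oscillate_eq_one_iff (hP : IsMarkovFamily (step Q p) P) (hQ1 : ∀ α, ∑ β, Q α β = 1)
    (hp : ∀ α k, p α k ∈ Set.Ioo (0 : ℝ) 1) :
    (∀ s, P s oscillate = 1) ↔ ∀ s : ι × ℤ, P s (hitEvent s.2) = 1 := by
  have := hP.isProb
  constructor
  · intro h s
    have ho : ∀ᵐ ω ∂P s, ω ∈ oscillate := (mem_ae_iff_prob_eq_one measurableSet_oscillate).2 (h s)
    refine (mem_ae_iff_prob_eq_one (measurableSet_hitEvent s.2)).1 ?_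
    filter_upwards [ho, hP.ae_posPath s] with ω h₁ h₂
    obtain ⟨a, ha, haℓ⟩ := frequently_atTop.1 (h₁.1 s.2) 1
    obtain ⟨b, hb, hbℓ⟩ := frequently_atTop.1 (h₁.2 s.2) a
    obtain ⟨c, hc, -, hcℓ⟩ :=
      exists_eq_of_le_of_le (x := fun n => (ω n).2) (nearestNeighbour_of_posPath hp h₂) hb
        haℓ.le hbℓ.le
    exact ⟨c, by omega, hcℓ⟩
  · intro h s
    have hrec : ∀ᵐ ω ∂P s, ∀ ℓ : ℤ, ∀ n, (ω n).2 = ℓ → ∃ᶠ k in atTop, (ω k).2 = ℓ :=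
      ae_all_iff.2 fun ℓ => hP.ae_frequently_of_return ℓ (fun α => h (α, ℓ)) s
    have hvisit : ∀ᵐ ω ∂P s, ∀ M : ℤ, M ≠ s.2 → ω ∉ frequentlyAvoiding s.2 {M} := by
      rw [ae_all_iff]
      intro M
      by_cases hM : M = s.2
      · exact Eventually.of_forall fun _ h => absurd hM h
      · filter_upwards [measure_eq_zero_iff_ae_notMem.1 (hP.frequentlyAvoiding_eq_zero s.2 {M}
          (returnAvoiding_lt_one hP hQ1 hp hM) s)] with ω hω _ using hω
    refine (mem_ae_iff_prob_eq_one measurableSet_oscillate).1 ?_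
    filter_upwards [hrec, hvisit, hP.ae_posPath s] with ω h₁ h₂ h₃
    have hi := h₁ s.2 0 (by rw [(h₃ 0).1])
    have hall : ∀ M : ℤ, ∃ᶠ n in atTop, (ω n).2 = M := by
      intro M
      by_cases hM : M = s.2
      · rwa [hM]
      · by_contra hcon
        refine h₂ M hM ⟨hi, fun n _ hn => hcon (h₁ M n hn)⟩
    exact ⟨fun M => (hall (M - 1)).mono fun n hn => by omega,
      fun M => (hall (M + 1)).mono fun n hn => by omega⟩

theorem driftBot_eq_one_iff (hP : IsMarkovFamily (step Q p) P) (hQ1 : ∀ α, ∑ β, Q α β = 1)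
    (hp : ∀ α k, p α k ∈ Set.Ioo (0 : ℝ) 1) :
    (∀ s, P s driftBot = 1) ↔ ∀ (s : ι × ℤ) (ℓ : ℤ),
      (ℓ < s.2 → P s (hitEvent ℓ) = 1) ∧ (s.2 < ℓ → P s (hitEvent ℓ) < 1) := by
  let r : ι × ℤ → ι × ℤ := fun s => (s.1, -s.2)
  have hr : Function.Involutive r := fun s => by simp [r]
  have hstep : (fun s t => step Q p (r s) (r t)) = step Q fun α k => 1 - p α (-k) := by
    funext s t
    simp only [step, r]
    congr 1
    by_cases h₁ : t.2 = s.2 + 1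
    · rw [if_neg (by omega), if_pos (by omega), if_pos h₁]
    · by_cases h₂ : t.2 = s.2 - 1
      · rw [if_pos (by omega), if_neg h₁, if_pos h₂, sub_sub_cancel]
      · rw [if_neg (by omega), if_neg (by omega), if_neg h₁, if_neg h₂]
  have hR := hP.map_involutive hr
  rw [hstep] at hR
  have hm : Measurable fun (ω : ℕ → ι × ℤ) k => r (ω k) := by fun_prop
  have hmain := driftTop_eq_one_iff hR hQ1 fun α k =>
    ⟨sub_pos.2 (hp α (-k)).2, by linarith [(hp α (-k)).1]⟩
  have hdrift : (fun (ω : ℕ → ι × ℤ) k => r (ω k)) ⁻¹' driftTop = driftBot := by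
    ext ω
    exact tendsto_neg_atTop_iff
  have hhit : ∀ ℓ : ℤ, (fun (ω : ℕ → ι × ℤ) k => r (ω k)) ⁻¹' hitEvent ℓ = hitEvent (-ℓ) := by
    intro ℓ
    ext ω
    exact exists_congr fun n => and_congr_right fun _ => neg_eq_iff_eq_neg
  simp only [Measure.map_apply hm measurableSet_driftTop, hdrift,
    Measure.map_apply hm (measurableSet_hitEvent _), hhit] at hmain
  rw [← hr.surjective.forall (p := fun s => P s driftBot = 1)] at hmain
  rw [hmain, hr.surjective.forall]
  refine forall_congr' fun s => ?_
  rw [neg_surjective.forall]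
  simp [r]

end Dichotomy

/-! ### Statement 6: Lemma `lem:main0` -/

theorem stmt6_lemma_main0 {m : ℕ} (hm : 0 < m)
    (Q : Matrix (Fin m) (Fin m) ℝ)
    (hQ0 : ∀ α β, 0 ≤ Q α β) (hQ1 : ∀ α, ∑ β, Q α β = 1)
    (p : Fin m → ℤ → ℝ) (hp : ∀ α k, p α k ∈ Set.Ioo (0 : ℝ) 1)
    (μ : Fin m → ℤ → Measure (ℕ → Fin m × ℤ)) (hμ : IsQuenchedLaw Q p μ) :
    ((∀ (α : Fin m) (i : ℤ), μ α i driftTop = 1) ↔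
      ∀ (α : Fin m) (i ℓ : ℤ),
        (i < ℓ → μ α i (hitEvent ℓ) = 1) ∧ (ℓ < i → μ α i (hitEvent ℓ) < 1)) ∧
    ((∀ (α : Fin m) (i : ℤ), μ α i driftBot = 1) ↔
      ∀ (α : Fin m) (i ℓ : ℤ),
        (ℓ < i → μ α i (hitEvent ℓ) = 1) ∧ (i < ℓ → μ α i (hitEvent ℓ) < 1)) ∧
    (MatIrreducible Q →
      ((∀ (α : Fin m) (i : ℤ), μ α i oscillate = 1) ↔
        ∀ (α : Fin m) (ℓ : ℤ), μ α ℓ (hitEvent ℓ) = 1)) := by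
  have hP := hμ.isMarkovFamily hQ0 hp
  refine ⟨?_, ?_, fun _ => ?_⟩
  · simpa only [Prod.forall] using driftTop_eq_one_iff hP hQ1 hp
  · simpa only [Prod.forall] using driftBot_eq_one_iff hP hQ1 hp
  · simpa only [Prod.forall] using oscillate_eq_one_iff hP hQ1 hp

end Parrondo
end

section
/- With γ_± = lim_{n→∞} (1/n)·log‖f_{±n,0}‖, one always has max(γ_+, γ_−) = 0. If in addition the Markov chain (G_n,X_n) is irreducible, then exactly one of the following three mutually exclusive cases occurs: (1) if γ_+ < 0 and γ_− = 0, then for every (α,i) ∈ {1,…,m}×ℤ, P^e_{αi}(lim_{n→∞} X_n = +∞) = 1 for a.e. e; (2) if γ_+ = 0 and γ_− < 0, then for every (α,i), P^e_{αi}(lim_{n→∞} X_n = −∞) = 1 for a.e. e; (3) if γ_+ = 0 = γ_−, then for every (α,i), P^e_{αi}(liminf_{n→∞} X_n = −∞ and limsup_{n→∞} X_n = +∞) = 1 for a.e. e. -/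
open MeasureTheory Filter Matrix
open scoped ENNReal Topology

namespace Parrondo

/-! ### Averaging over one step and hitting probabilities of half-lines -/

section Quenched

variable {ι : Type*} [Fintype ι] (Q : Matrix ι ι ℝ) (p : ι → ℤ → ℝ)

/-- The mean of `g` after one step of the walk from `(α, i)`. -/
def stepMean (g : ι → ℤ → ℝ) (α : ι) (i : ℤ) : ℝ :=
  ∑ β, Q α β * (p β i * g β (i + 1) + (1 - p β i) * g β (i - 1))

/-- The probability that the walk started at `(α, i)` satisfies `X_n ≤ ℓ` for some `n ≤ N`. -/
def hitBelowBy (ℓ : ℤ) : ℕ → ι → ℤ → ℝ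
  | 0 => fun _ i => if i ≤ ℓ then 1 else 0
  | N + 1 => fun α i => if i ≤ ℓ then 1 else stepMean Q p (hitBelowBy ℓ N) α i

/-- The probability that the walk started at `(α, i)` satisfies `X_n ≤ ℓ` for some `n`. -/
noncomputable def hitBelow (ℓ : ℤ) (α : ι) (i : ℤ) : ℝ := ⨆ N, hitBelowBy Q p ℓ N α i

/-- The maximum over the regimes of the probability of going from `i` to `(-∞, ℓ]`. -/
noncomputable def hitBelowMax (i ℓ : ℤ) : ℝ := ⨆ α, hitBelow Q p ℓ α i

/-- The environment seen by the reflected walk `-X`. -/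
def reflectEnv (p : ι → ℤ → ℝ) : ι → ℤ → ℝ := fun β k => 1 - p β (-k)

/-- `Q` is a stochastic matrix and `p` takes values in `(0, 1)`. -/
structure IsEnv : Prop where
  nonneg : ∀ α β, 0 ≤ Q α β
  sum_eq_one : ∀ α, ∑ β, Q α β = 1
  pos : ∀ α k, 0 < p α k
  lt_one : ∀ α k, p α k < 1

variable {Q p}

theorem IsEnv.reflect (h : IsEnv Q p) : IsEnv Q (reflectEnv p) where
  nonneg := h.nonneg
  sum_eq_one := h.sum_eq_one
  pos α k := sub_pos.2 (h.lt_one α (-k))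
  lt_one α k := sub_lt_self _ (h.pos α (-k))

theorem stepMean_reflectEnv (g : ι → ℤ → ℝ) (α : ι) (i : ℤ) :
    stepMean Q (reflectEnv p) g α i = stepMean Q p (fun β k => g β (-k)) α (-i) := by
  simp only [stepMean, reflectEnv]
  refine Finset.sum_congr rfl fun β _ => ?_
  rw [show -(-i + 1) = i - 1 by ring, show -(-i - 1) = i + 1 by ring]
  ring

theorem stepMean_mono (h : IsEnv Q p) {g g' : ι → ℤ → ℝ} {α : ι} {i : ℤ}
    (hr : ∀ β, g β (i + 1) ≤ g' β (i + 1)) (hl : ∀ β, g β (i - 1) ≤ g' β (i - 1)) :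
    stepMean Q p g α i ≤ stepMean Q p g' α i := by
  refine Finset.sum_le_sum fun β _ => mul_le_mul_of_nonneg_left ?_ (h.nonneg α β)
  exact add_le_add (mul_le_mul_of_nonneg_left (hr β) (h.pos β i).le)
    (mul_le_mul_of_nonneg_left (hl β) (sub_pos.2 (h.lt_one β i)).le)

theorem stepMean_const (h : IsEnv Q p) (c : ℝ) (α : ι) (i : ℤ) :
    stepMean Q p (fun _ _ => c) α i = c := by
  have : ∀ β, Q α β * (p β i * c + (1 - p β i) * c) = Q α β * c := fun β => by ring
  simp only [stepMean, this, ← Finset.sum_mul, h.sum_eq_one, one_mul]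

theorem stepMean_add (g g' : ι → ℤ → ℝ) (α : ι) (i : ℤ) :
    stepMean Q p (fun β k => g β k + g' β k) α i =
      stepMean Q p g α i + stepMean Q p g' α i := by
  simp only [stepMean, ← Finset.sum_add_distrib]
  exact Finset.sum_congr rfl fun β _ => by ring

theorem stepMean_mul_const (g : ι → ℤ → ℝ) (c : ℝ) (α : ι) (i : ℤ) :
    stepMean Q p (fun β k => g β k * c) α i = stepMean Q p g α i * c := by
  simp only [stepMean, Finset.sum_mul]
  exact Finset.sum_congr rfl fun β _ => by ring

theorem stepMean_neg (g : ι → ℤ → ℝ) (α : ι) (i : ℤ) :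
    stepMean Q p (fun β k => -g β k) α i = -stepMean Q p g α i := by
  simpa using stepMean_mul_const g (-1) α i

theorem IsEnv.exists_pos (h : IsEnv Q p) (α : ι) : ∃ β, 0 < Q α β := by
  by_contra! hn
  have := Finset.sum_nonpos fun β (_ : β ∈ Finset.univ) => hn β
  linarith [h.sum_eq_one α]

theorem stepMean_lt (h : IsEnv Q p) {g : ι → ℤ → ℝ} {α : ι} {i : ℤ} {c : ℝ}
    (hr : ∀ β, g β (i + 1) < c) (hl : ∀ β, g β (i - 1) ≤ c) : stepMean Q p g α i < c := by
  rw [← stepMean_const h c α i]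
  have hlt : ∀ β, p β i * g β (i + 1) + (1 - p β i) * g β (i - 1) <
      p β i * c + (1 - p β i) * c := fun β =>
    add_lt_add_of_lt_of_le (mul_lt_mul_of_pos_left (hr β) (h.pos β i))
      (mul_le_mul_of_nonneg_left (hl β) (sub_pos.2 (h.lt_one β i)).le)
  obtain ⟨β, hβ⟩ := h.exists_pos α
  exact Finset.sum_lt_sum
    (fun β _ => mul_le_mul_of_nonneg_left (hlt β).le (h.nonneg α β))
    ⟨β, Finset.mem_univ β, mul_lt_mul_of_pos_left (hlt β) hβ⟩

/-- The maximum principle on a finite box. -/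
theorem nonpos_of_le_stepMean (h : IsEnv Q p) {w : ι → ℤ → ℝ} {a b : ℤ}
    (hw : ∀ α i, a < i → i < b → w α i ≤ stepMean Q p w α i)
    (ha : ∀ α, w α a ≤ 0) (hb : ∀ α, w α b ≤ 0) {α : ι} {i : ℤ} (hai : a ≤ i) (hib : i ≤ b) :
    w α i ≤ 0 := by
  by_contra! hpos
  let S : Finset (ι × ℤ) := Finset.univ ×ˢ Finset.Icc a b
  have hmem : ∀ s : ι × ℤ, s ∈ S ↔ a ≤ s.2 ∧ s.2 ≤ b := fun s => by simp [S]
  obtain ⟨s, hs, hmax⟩ := S.exists_max_image (fun s => w s.1 s.2) ⟨(α, i), by simp [hmem, hai, hib]⟩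
  let S' := S.filter fun t => w s.1 s.2 ≤ w t.1 t.2
  obtain ⟨t, ht, htmax⟩ := S'.exists_max_image (fun t => t.2) ⟨s, by simp [S', hs]⟩
  obtain ⟨htS, hst⟩ := Finset.mem_filter.1 ht
  have hwt : 0 < w t.1 t.2 :=
    hpos.trans_le ((hmax (α, i) (by simp [hmem, hai, hib])).trans hst)
  obtain ⟨hat, htb⟩ := (hmem t).1 htS
  have hat' : a < t.2 := lt_of_le_of_ne hat fun he => by
    rw [← he] at hwt; exact (ha t.1).not_gt hwt
  have htb' : t.2 < b := lt_of_le_of_ne htb fun he => by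
    rw [he] at hwt; exact (hb t.1).not_gt hwt
  refine (hw t.1 t.2 hat' htb').not_gt (stepMean_lt h (fun β => ?_) fun β => ?_)
  · by_contra! hge
    have hβ : ((β, t.2 + 1) : ι × ℤ) ∈ S' := by
      refine Finset.mem_filter.2 ⟨(hmem _).2 ⟨?_, ?_⟩, hst.trans hge⟩ <;> dsimp only <;> omega
    have := htmax _ hβ
    dsimp only at this
    omega
  · exact (hmax (β, t.2 - 1) ((hmem _).2 ⟨by dsimp only; omega, by dsimp only; omega⟩)).trans hst

theorem hitBelowBy_of_le {ℓ i : ℤ} (hi : i ≤ ℓ) (N : ℕ) (α : ι) :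
    hitBelowBy Q p ℓ N α i = 1 := by
  cases N <;> simp [hitBelowBy, hi]

theorem hitBelowBy_succ_of_lt {ℓ i : ℤ} (hi : ℓ < i) (N : ℕ) (α : ι) :
    hitBelowBy Q p ℓ (N + 1) α i = stepMean Q p (hitBelowBy Q p ℓ N) α i := by
  simp [hitBelowBy, hi]

theorem hitBelowBy_nonneg (h : IsEnv Q p) (ℓ : ℤ) (N : ℕ) (α : ι) (i : ℤ) :
    0 ≤ hitBelowBy Q p ℓ N α i := by
  induction N generalizing α i with
  | zero => simp only [hitBelowBy]; split_ifs <;> norm_num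
  | succ N ih =>
    rcases le_or_gt i ℓ with hi | hi
    · simp [hitBelowBy_of_le hi]
    · rw [hitBelowBy_succ_of_lt hi, ← stepMean_const h 0 α i]
      exact stepMean_mono h (fun β => ih β _) fun β => ih β _

theorem hitBelowBy_le_one (h : IsEnv Q p) (ℓ : ℤ) (N : ℕ) (α : ι) (i : ℤ) :
    hitBelowBy Q p ℓ N α i ≤ 1 := by
  induction N generalizing α i with
  | zero => simp only [hitBelowBy]; split_ifs <;> norm_num
  | succ N ih =>
    rcases le_or_gt i ℓ with hi | hi
    · simp [hitBelowBy_of_le hi]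
    · rw [hitBelowBy_succ_of_lt hi, ← stepMean_const h 1 α i]
      exact stepMean_mono h (fun β => ih β _) fun β => ih β _

theorem hitBelowBy_le_succ (h : IsEnv Q p) (ℓ : ℤ) (N : ℕ) (α : ι) (i : ℤ) :
    hitBelowBy Q p ℓ N α i ≤ hitBelowBy Q p ℓ (N + 1) α i := by
  induction N generalizing α i with
  | zero =>
    rcases le_or_gt i ℓ with hi | hi
    · simp [hitBelowBy_of_le hi]
    · simpa [hitBelowBy, hi.not_ge] using hitBelowBy_nonneg h ℓ 1 α i
  | succ N ih =>
    rcases le_or_gt i ℓ with hi | hi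
    · simp [hitBelowBy_of_le hi]
    · rw [hitBelowBy_succ_of_lt hi, hitBelowBy_succ_of_lt hi]
      exact stepMean_mono h (fun β => ih β _) fun β => ih β _

theorem bddAbove_hitBelowBy (h : IsEnv Q p) (ℓ : ℤ) (α : ι) (i : ℤ) :
    BddAbove (Set.range fun N => hitBelowBy Q p ℓ N α i) :=
  ⟨1, Set.forall_mem_range.2 fun N => hitBelowBy_le_one h ℓ N α i⟩

theorem tendsto_hitBelowBy (h : IsEnv Q p) (ℓ : ℤ) (α : ι) (i : ℤ) :
    Tendsto (fun N => hitBelowBy Q p ℓ N α i) atTop (𝓝 (hitBelow Q p ℓ α i)) :=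
  tendsto_atTop_ciSup (monotone_nat_of_le_succ fun N => hitBelowBy_le_succ h ℓ N α i)
    (bddAbove_hitBelowBy h ℓ α i)

theorem hitBelowBy_le_hitBelow (h : IsEnv Q p) (ℓ : ℤ) (N : ℕ) (α : ι) (i : ℤ) :
    hitBelowBy Q p ℓ N α i ≤ hitBelow Q p ℓ α i :=
  le_ciSup (bddAbove_hitBelowBy h ℓ α i) N

theorem hitBelow_of_le {ℓ i : ℤ} (hi : i ≤ ℓ) (α : ι) : hitBelow Q p ℓ α i = 1 := by
  simp [hitBelow, hitBelowBy_of_le hi]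

theorem hitBelow_nonneg (h : IsEnv Q p) (ℓ : ℤ) (α : ι) (i : ℤ) : 0 ≤ hitBelow Q p ℓ α i :=
  Real.iSup_nonneg fun N => hitBelowBy_nonneg h ℓ N α i

theorem hitBelow_le_one (h : IsEnv Q p) (ℓ : ℤ) (α : ι) (i : ℤ) : hitBelow Q p ℓ α i ≤ 1 :=
  ciSup_le fun N => hitBelowBy_le_one h ℓ N α i

theorem hitBelow_eq_stepMean (h : IsEnv Q p) {ℓ i : ℤ} (hi : ℓ < i) (α : ι) :
    hitBelow Q p ℓ α i = stepMean Q p (hitBelow Q p ℓ) α i := by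
  refine tendsto_nhds_unique ((tendsto_hitBelowBy h ℓ α i).comp (tendsto_add_atTop_nat 1)) ?_
  simp only [Function.comp_def, hitBelowBy_succ_of_lt hi]
  exact tendsto_finsetSum _ fun β _ => (((tendsto_hitBelowBy h ℓ β _).const_mul _).add
    ((tendsto_hitBelowBy h ℓ β _).const_mul _)).const_mul _

/-- To reach `(-∞, ℓ]` from the right of `k ≥ ℓ`, the walk has to pass through `k`. -/
theorem hitBelow_le_mul (h : IsEnv Q p) {ℓ k i : ℤ} (hℓk : ℓ ≤ k) (hki : k ≤ i) {M : ℝ}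
    (hM : ∀ β, hitBelow Q p ℓ β k ≤ M) (α : ι) :
    hitBelow Q p ℓ α i ≤ hitBelow Q p k α i * M := by
  have hM0 : 0 ≤ M := (hitBelow_nonneg h ℓ α k).trans (hM α)
  refine ciSup_le fun N => ?_
  induction N generalizing α i with
  | zero =>
    rcases hki.eq_or_lt with rfl | hlt
    · rw [hitBelow_of_le le_rfl, one_mul]
      exact (hitBelowBy_le_hitBelow h ..).trans (hM α)
    · simpa [hitBelowBy, (hℓk.trans_lt hlt).not_ge] using
        mul_nonneg (hitBelow_nonneg h k α i) hM0
  | succ N ih =>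
    rcases hki.eq_or_lt with rfl | hlt
    · rw [hitBelow_of_le le_rfl, one_mul]
      exact (hitBelowBy_le_hitBelow h ..).trans (hM α)
    · rw [hitBelowBy_succ_of_lt (hℓk.trans_lt hlt), hitBelow_eq_stepMean h hlt,
        ← stepMean_mul_const]
      exact stepMean_mono h (fun β => ih (by omega) β) fun β => ih (by omega) β

theorem hitBelow_mono (h : IsEnv Q p) {ℓ k : ℤ} (hℓk : ℓ ≤ k) (α : ι) (i : ℤ) :
    hitBelow Q p ℓ α i ≤ hitBelow Q p k α i := by
  rcases le_total i k with hi | hi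
  · rw [hitBelow_of_le hi]
    exact hitBelow_le_one h ..
  · simpa using hitBelow_le_mul h hℓk hi (fun β => hitBelow_le_one h ℓ β k) α

/-- The walk leaves every finite box. -/
theorem one_le_hitBelow_add (h : IsEnv Q p) {a b i : ℤ} (hai : a ≤ i) (hib : i ≤ b) (α : ι) :
    1 ≤ hitBelow Q p a α i + hitBelow Q (reflectEnv p) (-b) α (-i) := by
  have := nonpos_of_le_stepMean h (a := a) (b := b) (α := α) (i := i)
    (w := fun β k => 1 + -(hitBelow Q p a β k + hitBelow Q (reflectEnv p) (-b) β (-k)))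
    (fun β k hak hkb => ?_) (fun β => ?_) (fun β => ?_) hai hib
  · linarith
  · rw [stepMean_add (fun _ _ => 1), stepMean_neg, stepMean_const h,
      stepMean_add (hitBelow Q p a), ← hitBelow_eq_stepMean h hak,
      hitBelow_eq_stepMean h.reflect (neg_lt_neg hkb), stepMean_reflectEnv]
    simp
  · linarith [hitBelow_of_le (Q := Q) (p := p) (le_refl a) β,
      hitBelow_nonneg h.reflect (-b) β (-a)]
  · linarith [hitBelow_of_le (Q := Q) (p := reflectEnv p) (le_refl (-b)) β,
      hitBelow_nonneg h a β b]

theorem hitBelow_lt_one_of_step (h : IsEnv Q p) {ℓ : ℤ} {s s' : ι × ℤ} (hs : ℓ < s.2)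
    (hstep : StepPos Q s s') (hs' : hitBelow Q p ℓ s'.1 s'.2 < 1) :
    hitBelow Q p ℓ s.1 s.2 < 1 := by
  obtain ⟨hQ, hx⟩ := hstep
  rw [hitBelow_eq_stepMean h hs]
  conv_rhs => rw [← stepMean_const h 1 s.1 s.2]
  have hr : ∀ β, p β s.2 * hitBelow Q p ℓ β (s.2 + 1) ≤ p β s.2 * 1 := fun β =>
    mul_le_mul_of_nonneg_left (hitBelow_le_one h ..) (h.pos ..).le
  have hl : ∀ β, (1 - p β s.2) * hitBelow Q p ℓ β (s.2 - 1) ≤ (1 - p β s.2) * 1 := fun β =>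
    mul_le_mul_of_nonneg_left (hitBelow_le_one h ..) (sub_pos.2 (h.lt_one ..)).le
  refine Finset.sum_lt_sum (fun β _ => mul_le_mul_of_nonneg_left (add_le_add (hr β) (hl β))
    (h.nonneg ..)) ⟨s'.1, Finset.mem_univ _, mul_lt_mul_of_pos_left ?_ hQ⟩
  rcases hx with hx | hx <;> rw [hx] at hs'
  · exact add_lt_add_of_lt_of_le (mul_lt_mul_of_pos_left hs' (h.pos ..)) (hl _)
  · exact add_lt_add_of_le_of_lt (hr _)
      (mul_lt_mul_of_pos_left hs' (sub_pos.2 (h.lt_one ..)))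

theorem hitBelow_pos (h : IsEnv Q p) (ℓ : ℤ) (α : ι) (n : ℕ) : 0 < hitBelow Q p ℓ α (ℓ + n) := by
  induction n generalizing α with
  | zero => simp [hitBelow_of_le]
  | succ n ih =>
    rw [hitBelow_eq_stepMean h (by push_cast; omega)]
    have hterm : ∀ β, 0 < p β (ℓ + ↑(n + 1)) * hitBelow Q p ℓ β (ℓ + ↑(n + 1) + 1) +
        (1 - p β (ℓ + ↑(n + 1))) * hitBelow Q p ℓ β (ℓ + ↑(n + 1) - 1) := fun β => by
      refine add_pos_of_nonneg_of_pos
        (mul_nonneg (h.pos ..).le (hitBelow_nonneg h ..))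
        (mul_pos (sub_pos.2 (h.lt_one ..)) ?_)
      rw [show ℓ + ((n + 1 : ℕ) : ℤ) - 1 = ℓ + n by push_cast; ring]
      exact ih β
    obtain ⟨β, hβ⟩ := h.exists_pos α
    exact Finset.sum_pos' (fun β _ => mul_nonneg (h.nonneg ..) (hterm β).le)
      ⟨β, Finset.mem_univ β, mul_pos hβ (hterm β)⟩

theorem bddAbove_hitBelow (i ℓ : ℤ) : BddAbove (Set.range fun α => hitBelow Q p ℓ α i) :=
  (Set.finite_range _).bddAbove

theorem hitBelow_le_hitBelowMax (ℓ : ℤ) (α : ι) (i : ℤ) :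
    hitBelow Q p ℓ α i ≤ hitBelowMax Q p i ℓ :=
  le_ciSup (bddAbove_hitBelow i ℓ) α

theorem hitBelowMax_le_one [Nonempty ι] (h : IsEnv Q p) (i ℓ : ℤ) : hitBelowMax Q p i ℓ ≤ 1 :=
  ciSup_le fun α => hitBelow_le_one h ℓ α i

theorem hitBelowMax_nonneg (h : IsEnv Q p) (i ℓ : ℤ) : 0 ≤ hitBelowMax Q p i ℓ :=
  Real.iSup_nonneg fun α => hitBelow_nonneg h ℓ α i

theorem hitBelowMax_pos [Nonempty ι] (h : IsEnv Q p) (i ℓ : ℤ) : 0 < hitBelowMax Q p i ℓ := by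
  obtain ⟨α⟩ := ‹Nonempty ι›
  refine lt_of_lt_of_le ?_ (hitBelow_le_hitBelowMax ℓ α i)
  rcases le_total i ℓ with hi | hi
  · simp [hitBelow_of_le hi]
  · obtain ⟨n, hn⟩ := Int.eq_ofNat_of_zero_le (sub_nonneg.2 hi)
    simpa [← hn] using hitBelow_pos h ℓ α n

theorem hitBelowMax_of_le [Nonempty ι] {i ℓ : ℤ} (hi : i ≤ ℓ) : hitBelowMax Q p i ℓ = 1 := by
  simp [hitBelowMax, hitBelow_of_le hi]

theorem hitBelowMax_le_mul [Nonempty ι] (h : IsEnv Q p) {ℓ k i : ℤ} (hℓk : ℓ ≤ k)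
    (hki : k ≤ i) : hitBelowMax Q p i ℓ ≤ hitBelowMax Q p i k * hitBelowMax Q p k ℓ :=
  ciSup_le fun α => (hitBelow_le_mul h hℓk hki
    (fun β => hitBelow_le_hitBelowMax ℓ β k) α).trans
      (mul_le_mul_of_nonneg_right (hitBelow_le_hitBelowMax ..) (hitBelowMax_nonneg h ..))

theorem one_le_hitBelowMax_add [Nonempty ι] (h : IsEnv Q p) (n : ℕ) :
    1 ≤ hitBelowMax Q p 0 (-n) + hitBelowMax Q (reflectEnv p) 0 (-n) := by
  obtain ⟨α⟩ := ‹Nonempty ι›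
  have := one_le_hitBelow_add h (a := -n) (b := n) (i := 0) (by simp) (by simp) α
  rw [neg_zero] at this
  exact this.trans (add_le_add (hitBelow_le_hitBelowMax ..) (hitBelow_le_hitBelowMax ..))

/-- For an irreducible chain, if from every site some regime leads almost surely to any site on
the left, then all of them do. -/
theorem hitBelow_eq_one_of_irreducible [Nonempty ι] (h : IsEnv Q p) (hirr : ChainIrreducible Q)
    (hone : ∀ i ℓ, ℓ ≤ i → hitBelowMax Q p i ℓ = 1) (ℓ : ℤ) (β : ι) (j : ℤ) :
    hitBelow Q p ℓ β j = 1 := by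
  choose n c hc0 hcn hc using fun α : ι => hirr (α, j) (β, j)
  set ℓ' := min ℓ j - (∑ α, n α : ℕ) - 1 with hℓ'
  obtain ⟨α, hα⟩ := exists_eq_ciSup_of_finite (f := fun α => hitBelow Q p ℓ' α j)
  have hαone : hitBelow Q p ℓ' α j = 1 := hα.trans (hone j ℓ' (by omega))
  have hnα : n α ≤ ∑ α, n α := Finset.single_le_sum (fun _ _ => Nat.zero_le _) (Finset.mem_univ α)
  have key : ∀ k ≤ n α, j - k ≤ (c α k).2 ∧ hitBelow Q p ℓ' (c α k).1 (c α k).2 = 1 := by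
    intro k hk
    induction k with
    | zero => simp [hc0, hαone]
    | succ k ih =>
      obtain ⟨h1, h2⟩ := ih (by omega)
      have hst := hc α k (by omega)
      refine ⟨by rcases hst.2 with hx | hx <;> rw [hx] <;> push_cast <;> omega, ?_⟩
      by_contra hne
      exact (hitBelow_lt_one_of_step h (by omega) hst
        (lt_of_le_of_ne (hitBelow_le_one h ..) hne)).ne h2
  have hβ := (key (n α) le_rfl).2
  rw [hcn] at hβ
  exact le_antisymm (hitBelow_le_one h ..) (hβ ▸ hitBelow_mono h (by omega) β j)

theorem hitBelowBy_shift {p' : ι → ℤ → ℝ} {c : ℤ} (hp : ∀ α k, p' α k = p α (k + c)) (ℓ : ℤ)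
    (N : ℕ) (α : ι) (i : ℤ) :
    hitBelowBy Q p' ℓ N α i = hitBelowBy Q p (ℓ + c) N α (i + c) := by
  induction N generalizing α i with
  | zero => simp [hitBelowBy]
  | succ N ih =>
    simp only [hitBelowBy, stepMean, ih, hp, add_le_add_iff_right, add_right_comm i 1 c,
      add_sub_right_comm i c 1]

theorem hitBelowMax_shift {p' : ι → ℤ → ℝ} {c : ℤ} (hp : ∀ α k, p' α k = p α (k + c))
    (i ℓ : ℤ) : hitBelowMax Q p' i ℓ = hitBelowMax Q p (i + c) (ℓ + c) := by
  simp only [hitBelowMax, hitBelow, hitBelowBy_shift hp]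

theorem measurable_hitBelowMax {E : Type*} [MeasurableSpace E] {p : ι → ℤ → E → ℝ}
    (hp : ∀ α k, Measurable (p α k)) (i ℓ : ℤ) :
    Measurable fun e => hitBelowMax Q (fun α k => p α k e) i ℓ := by
  refine Measurable.iSup fun α => Measurable.iSup fun N => ?_
  induction N generalizing α i with
  | zero => exact measurable_const
  | succ N ih =>
    simp only [hitBelowBy]
    split_ifs
    · exact measurable_const
    · exact Finset.measurable_fun_sum _ fun β _ => (((hp β i).mul (ih _ β)).add
        ((measurable_const.sub (hp β i)).mul (ih _ β))).const_mul _

end Quenched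

/-! ### Path measures -/

section PathMeasure

variable {S : Type*} [Countable S] [MeasurableSpace S] [MeasurableSingletonClass S]

theorem measurableSet_coord {A : Set S} (n : ℕ) : MeasurableSet {ω : ℕ → S | ω n ∈ A} :=
  measurable_pi_apply n A.to_countable.measurableSet

theorem measurableSet_cylinder (n : ℕ) (t : ℕ → S) :
    MeasurableSet {ω : ℕ → S | ∀ k ≤ n, ω k = t k} := by
  simp only [Set.ofPred_forall]
  exact .iInter fun k => .iInter fun _ => measurableSet_coord (A := {t k}) k

/-- Two probability measures on path space with the same values on cylinders coincide. -/
theorem measure_path_ext {μ ν : Measure (ℕ → S)} [IsProbabilityMeasure μ]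
    [IsProbabilityMeasure ν]
    (h : ∀ (n : ℕ) (t : ℕ → S), μ {ω | ∀ k ≤ n, ω k = t k} = ν {ω | ∀ k ≤ n, ω k = t k}) : μ = ν := by
  let C : Set (Set (ℕ → S)) :=
    insert ∅ (Set.range fun x : ℕ × (ℕ → S) => {ω | ∀ k ≤ x.1, ω k = x.2 k})
  have hC : ∀ (n : ℕ) (t : ℕ → S), {ω : ℕ → S | ∀ k ≤ n, ω k = t k} ∈ C := fun n t => Or.inr ⟨(n, t), rfl⟩
  refine ext_of_generate_finite C (le_antisymm ?_ ?_) ?_ ?_ (by simp)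
  · refine iSup_le fun n => ?_
    rintro _ ⟨A, -, rfl⟩
    have heq : (fun ω : ℕ → S => ω n) ⁻¹' A =
        ⋃ u : {u : Fin (n + 1) → S // u (Fin.last n) ∈ A},
          {ω | ∀ k ≤ n, ω k = u.1 (Fin.ofNat (n + 1) k)} := by
      ext ω
      simp only [Set.mem_preimage, Set.mem_iUnion, Set.mem_ofPred_eq]
      constructor
      · intro hω
        refine ⟨⟨fun k => ω k, by simpa using hω⟩, fun k hk => ?_⟩
        simp [Nat.mod_eq_of_lt (Nat.lt_succ_of_le hk)]
      · rintro ⟨u, hu⟩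
        rw [hu n le_rfl]
        convert u.2
        ext
        simp
    rw [heq]
    exact MeasurableSet.iUnion fun u => MeasurableSpace.measurableSet_generateFrom (hC _ _)
  · refine MeasurableSpace.generateFrom_le ?_
    rintro _ (rfl | ⟨x, rfl⟩)
    · exact MeasurableSet.empty
    · exact measurableSet_cylinder x.1 x.2
  · rintro _ (rfl | ⟨⟨n, t⟩, rfl⟩) _ (rfl | ⟨⟨n', t'⟩, rfl⟩) ⟨ω, hω, hω'⟩
    · exact hω.elim
    · exact hω.elim
    · exact hω'.elim
    · have : {ω : ℕ → S | ∀ k ≤ n, ω k = t k} ∩ {ω | ∀ k ≤ n', ω k = t' k} =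
          {ω' | ∀ k ≤ max n n', ω' k = ω k} := by
        ext ω'
        simp only [Set.mem_inter_iff, Set.mem_ofPred_eq, le_max_iff] at hω hω' ⊢
        constructor
        · rintro ⟨h1, h2⟩ k (hk | hk)
          · rw [h1 k hk, hω k hk]
          · rw [h2 k hk, hω' k hk]
        · exact fun h => ⟨fun k hk => (h k (.inl hk)).trans (hω k hk),
            fun k hk => (h k (.inr hk)).trans (hω' k hk)⟩
      exact this ▸ hC _ _
  · rintro _ (rfl | ⟨x, rfl⟩)
    · simp
    · exact h x.1 x.2

end PathMeasure

section Reflect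

variable {ι : Type*} [MeasurableSpace ι]

/-- The path `(G, -X)`. -/
def reflectPath {ι : Type*} (ω : ℕ → ι × ℤ) : ℕ → ι × ℤ := fun n => ((ω n).1, -(ω n).2)

/-- The laws of `(G, -X)`. -/
noncomputable def reflectLaw (μ : ι → ℤ → Measure (ℕ → ι × ℤ)) :
    ι → ℤ → Measure (ℕ → ι × ℤ) :=
  fun α i => (μ α (-i)).map reflectPath

theorem measurable_reflectPath : Measurable (reflectPath (ι := ι)) :=
  measurable_pi_lambda _ fun n => (measurable_fst.comp (measurable_pi_apply n)).prodMk
    (measurable_snd.comp (measurable_pi_apply n)).neg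

end Reflect

section Law

variable {ι : Type*} [Fintype ι] [DecidableEq ι] [MeasurableSpace ι] [MeasurableSingletonClass ι]
  {Q : Matrix ι ι ℝ} {p : ι → ℤ → ℝ} {μ : ι → ℤ → Measure (ℕ → ι × ℤ)}

theorem IsQuenchedLaw.start (hμ : IsQuenchedLaw Q p μ) (α : ι) (i : ℤ) :
    ∀ᵐ ω ∂μ α i, ω 0 = (α, i) := by
  have := (hμ α i).1
  refine (prob_compl_eq_zero_iff (measurableSet_coord (A := {(α, i)}) 0)).2 ?_
  simpa using (hμ α i).2 0 fun _ => (α, i)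

/-- The Markov property at time one. -/
theorem IsQuenchedLaw.map_shift (hμ : IsQuenchedLaw Q p μ) (h : IsEnv Q p) (α : ι) (i : ℤ) :
    (μ α i).map (fun ω n => ω (n + 1)) =
      ∑ β, (ENNReal.ofReal (Q α β * p β i) • μ β (i + 1) +
        ENNReal.ofReal (Q α β * (1 - p β i)) • μ β (i - 1)) := by
  have hprob : ∀ α i, IsProbabilityMeasure (μ α i) := fun α i => (hμ α i).1
  have hmeas : Measurable fun (ω : ℕ → ι × ℤ) n => ω (n + 1) :=
    measurable_pi_lambda _ fun n => measurable_pi_apply (n + 1)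
  have hr : ∀ β, 0 ≤ Q α β * p β i := fun β => mul_nonneg (h.nonneg ..) (h.pos ..).le
  have hl : ∀ β, 0 ≤ Q α β * (1 - p β i) := fun β =>
    mul_nonneg (h.nonneg ..) (sub_pos.2 (h.lt_one ..)).le
  have : IsProbabilityMeasure ((μ α i).map (fun ω n => ω (n + 1))) :=
    Measure.isProbabilityMeasure_map hmeas.aemeasurable
  have : IsProbabilityMeasure (∑ β, (ENNReal.ofReal (Q α β * p β i) • μ β (i + 1) +
        ENNReal.ofReal (Q α β * (1 - p β i)) • μ β (i - 1))) := by
    refine ⟨?_⟩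
    simp only [Measure.coe_finsetSum, Finset.sum_apply, Measure.coe_add, Pi.add_apply,
      Measure.smul_apply, measure_univ, smul_eq_mul, mul_one]
    have hsum : ∀ β, ENNReal.ofReal (Q α β * p β i) + ENNReal.ofReal (Q α β * (1 - p β i)) =
        ENNReal.ofReal (Q α β) := fun β => by
      rw [← ENNReal.ofReal_add (hr β) (hl β)]
      congr 1
      ring
    simp only [hsum]
    rw [← ENNReal.ofReal_sum_of_nonneg fun β _ => h.nonneg α β, h.sum_eq_one, ENNReal.ofReal_one]
  refine measure_path_ext fun n t => ?_
  rw [Measure.map_apply hmeas (measurableSet_cylinder n t)]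
  let t' : ℕ → ι × ℤ := fun k => Nat.casesOn k (α, i) t
  have h1 : μ α i ((fun ω n => ω (n + 1)) ⁻¹' {ω | ∀ k ≤ n, ω k = t k}) =
      μ α i {ω | ∀ k ≤ n + 1, ω k = t' k} := by
    refine measure_congr ?_
    filter_upwards [hμ.start α i] with ω hω
    refine propext ⟨fun hs k hk => ?_, fun hs k hk => hs (k + 1) (Nat.succ_le_succ hk)⟩
    cases k with
    | zero => exact hω
    | succ k => exact hs k (Nat.le_of_succ_le_succ hk)
  rw [h1, (hμ α i).2, if_pos (show t' 0 = (α, i) from rfl), one_mul, Finset.prod_range_succ']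
  simp only [Measure.coe_finsetSum, Finset.sum_apply, Measure.coe_add, Pi.add_apply,
      Measure.smul_apply, smul_eq_mul, (hμ _ _).2 n t, ← mul_assoc, ← add_mul, ← Finset.sum_mul]
  have hstep0 : 0 ≤ step Q p (t' 0) (t' (0 + 1)) := by
    refine mul_nonneg (h.nonneg ..) ?_
    split_ifs
    exacts [(h.pos ..).le, (sub_pos.2 (h.lt_one ..)).le, le_rfl]
  rw [mul_comm, ENNReal.ofReal_mul hstep0]
  congr 1
  rw [Finset.sum_eq_single (t 0).1]
  · rcases ht : t 0 with ⟨β, j⟩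
    simp only [step, t', ht, Prod.mk.injEq, true_and]
    by_cases h1 : j = i + 1
    · subst h1
      simp [show ¬ (i + 1 = i - 1) by omega]
    · by_cases h2 : j = i - 1
      · subst h2
        simp [show ¬ (i - 1 = i + 1) by omega]
      · simp [h1, h2]
  · intro β _ hβ
    simp [Prod.ext_iff, Ne.symm hβ]
  · simp

theorem IsQuenchedLaw.real_shift (hμ : IsQuenchedLaw Q p μ) (h : IsEnv Q p) (α : ι) (i : ℤ)
    {B : Set (ℕ → ι × ℤ)} (hB : MeasurableSet B) :
    (μ α i).real {ω | (fun n => ω (n + 1)) ∈ B} = stepMean Q p (fun β k => (μ β k).real B) α i := by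
  have hprob : ∀ α i, IsProbabilityMeasure (μ α i) := fun α i => (hμ α i).1
  have hmeas : Measurable fun (ω : ℕ → ι × ℤ) n => ω (n + 1) :=
    measurable_pi_lambda _ fun n => measurable_pi_apply (n + 1)
  have h1 := congrArg (fun ν => ν.real B) (hμ.map_shift h α i)
  simp only [map_measureReal_apply hmeas hB] at h1
  refine h1.trans ?_
  have hr : ∀ β, 0 ≤ Q α β * p β i := fun β => mul_nonneg (h.nonneg ..) (h.pos ..).le
  have hl : ∀ β, 0 ≤ Q α β * (1 - p β i) := fun β =>
    mul_nonneg (h.nonneg ..) (sub_pos.2 (h.lt_one ..)).le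
  simp only [stepMean, Measure.real, Measure.coe_finsetSum, Finset.sum_apply, Measure.coe_add,
    Pi.add_apply, Measure.smul_apply, smul_eq_mul]
  rw [ENNReal.toReal_sum fun β _ => by finiteness]
  refine Finset.sum_congr rfl fun β _ => ?_
  rw [ENNReal.toReal_add (by finiteness) (by finiteness), ENNReal.toReal_mul, ENNReal.toReal_mul,
    ENNReal.toReal_ofReal (hr β), ENNReal.toReal_ofReal (hl β)]
  ring

theorem IsQuenchedLaw.real_hit_by (hμ : IsQuenchedLaw Q p μ) (h : IsEnv Q p) {ℓ : ℤ} {A : Set ℤ}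
    (hA : ∀ i, ℓ ≤ i → (i ∈ A ↔ i = ℓ)) (N : ℕ) (α : ι) {i : ℤ} (hi : ℓ ≤ i) :
    (μ α i).real {ω | ∃ n ≤ N, (ω n).2 ∈ A} = hitBelowBy Q p ℓ N α i := by
  have hprob : ∀ α i, IsProbabilityMeasure (μ α i) := fun α i => (hμ α i).1
  rcases hi.eq_or_lt with rfl | hlt
  · rw [hitBelowBy_of_le le_rfl, ← probReal_univ (μ := μ α ℓ)]
    refine measureReal_congr ?_
    filter_upwards [hμ.start α ℓ] with ω hω
    exact propext ⟨fun _ => trivial, fun _ => ⟨0, Nat.zero_le N, by simp [hω, hA]⟩⟩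
  induction N generalizing α i with
  | zero =>
    simp only [hitBelowBy]
    rw [if_neg hlt.not_ge, ← measureReal_empty (μ := μ α i)]
    refine measureReal_congr ?_
    filter_upwards [hμ.start α i] with ω hω
    refine propext ⟨?_, False.elim⟩
    rintro ⟨n, hn, hnA⟩
    obtain rfl : n = 0 := by omega
    rw [hω] at hnA
    exact hlt.ne' ((hA i hi).1 hnA)
  | succ N ih =>
    rw [hitBelowBy_succ_of_lt hlt]
    have hmeas : MeasurableSet {ω : ℕ → ι × ℤ | ∃ n ≤ N, (ω n).2 ∈ A} := by
      simp only [Set.ofPred_exists, ← exists_prop]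
      exact .iUnion fun n => .iUnion fun _ => measurableSet_coord (A := Prod.snd ⁻¹' A) n
    have h1 : (μ α i).real {ω | ∃ n ≤ N + 1, (ω n).2 ∈ A} =
        (μ α i).real {ω | (fun n => ω (n + 1)) ∈ {ω : ℕ → ι × ℤ | ∃ n ≤ N, (ω n).2 ∈ A}} := by
      refine measureReal_congr ?_
      filter_upwards [hμ.start α i] with ω hω
      refine propext ⟨?_, ?_⟩
      · rintro ⟨n, hn, hnA⟩
        cases n with
        | zero =>
          rw [hω] at hnA
          exact (hlt.ne' ((hA i hi).1 hnA)).elim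
        | succ n => exact ⟨n, by omega, hnA⟩
      · rintro ⟨n, hn, hnA⟩
        exact ⟨n + 1, by omega, hnA⟩
    have hval : ∀ β k, ℓ ≤ k →
        (μ β k).real {ω | ∃ n ≤ N, (ω n).2 ∈ A} = hitBelowBy Q p ℓ N β k := by
      intro β k hk
      rcases hk.eq_or_lt with rfl | hk'
      · rw [hitBelowBy_of_le le_rfl, ← probReal_univ (μ := μ β ℓ)]
        refine measureReal_congr ?_
        filter_upwards [hμ.start β ℓ] with ω hω
        exact propext ⟨fun _ => trivial, fun _ => ⟨0, Nat.zero_le N, by simp [hω, hA]⟩⟩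
      · exact ih β hk hk'
    rw [h1, hμ.real_shift h α i hmeas]
    refine Finset.sum_congr rfl fun β _ => ?_
    dsimp only
    rw [hval β (i + 1) (by omega), hval β (i - 1) (by omega)]

theorem IsQuenchedLaw.real_hit (hμ : IsQuenchedLaw Q p μ) (h : IsEnv Q p) {ℓ : ℤ} {A : Set ℤ}
    (hA : ∀ i, ℓ ≤ i → (i ∈ A ↔ i = ℓ)) (α : ι) {i : ℤ} (hi : ℓ ≤ i) :
    (μ α i).real {ω | ∃ n, (ω n).2 ∈ A} = hitBelow Q p ℓ α i := by
  have := (hμ α i).1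
  refine tendsto_nhds_unique ?_ (tendsto_hitBelowBy h ℓ α i)
  simp only [← hμ.real_hit_by h hA _ α hi]
  have heq : {ω : ℕ → ι × ℤ | ∃ n, (ω n).2 ∈ A} = ⋃ N, {ω | ∃ n ≤ N, (ω n).2 ∈ A} := by
    ext ω
    simp only [Set.mem_ofPred_eq, Set.mem_iUnion]
    exact ⟨fun ⟨n, hn⟩ => ⟨n, n, le_rfl, hn⟩, fun ⟨_, n, _, hn⟩ => ⟨n, hn⟩⟩
  rw [heq]
  refine (ENNReal.tendsto_toReal (measure_ne_top _ _)).comp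
    (tendsto_measure_iUnion_atTop fun N M hNM ω => ?_)
  rintro ⟨n, hn, hnA⟩
  exact ⟨n, hn.trans hNM, hnA⟩

theorem IsQuenchedLaw.real_hit_le (hμ : IsQuenchedLaw Q p μ) (h : IsEnv Q p) (ℓ : ℤ) (α : ι)
    (i : ℤ) : (μ α i).real {ω | ∃ n, (ω n).2 ≤ ℓ} = hitBelow Q p ℓ α i := by
  have := (hμ α i).1
  rcases le_total ℓ i with hi | hi
  · exact hμ.real_hit h (A := Set.Iic ℓ)
      (fun j hj => ⟨fun hj' => le_antisymm hj' hj, fun hj' => hj'.le⟩) α hi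
  · rw [hitBelow_of_le hi, ← probReal_univ (μ := μ α i)]
    refine measureReal_congr ?_
    filter_upwards [hμ.start α i] with ω hω
    exact propext ⟨fun _ => trivial, fun _ => ⟨0, by rw [hω]; exact hi⟩⟩

theorem IsQuenchedLaw.fnorm_eq (hμ : IsQuenchedLaw Q p μ) (h : IsEnv Q p) {i ℓ : ℤ}
    (hi : ℓ < i) : fnorm μ i ℓ = hitBelowMax Q p i ℓ := by
  refine iSup_congr fun α => ?_
  rw [← hμ.real_hit h (A := {ℓ}) (fun _ _ => Iff.rfl) α hi.le]
  refine measureReal_congr ?_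
  filter_upwards [hμ.start α i] with ω hω
  refine propext ⟨fun ⟨n, _, hn⟩ => ⟨n, hn⟩, fun ⟨n, hn⟩ => ⟨n, ?_, hn⟩⟩
  by_contra hn0
  obtain rfl : n = 0 := by omega
  rw [hω] at hn
  exact hi.ne' hn

/-- If the walk a.s. stays bounded below and returns are unlikely from far on the right,
then it drifts to `+∞`. -/
theorem IsQuenchedLaw.driftTop (hμ : IsQuenchedLaw Q p μ) (h : IsEnv Q p)
    (hbelow : ∀ i, Tendsto (fun n : ℕ => hitBelowMax Q p i (-n)) atTop (𝓝 0))
    (hreturn : ∀ ℓ, Tendsto (fun n : ℕ => hitBelowMax Q p n ℓ) atTop (𝓝 0)) (α : ι) (i : ℤ) :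
    μ α i driftTop = 1 := by
  have hprob : ∀ α i, IsProbabilityMeasure (μ α i) := fun α i => (hμ α i).1
  have hmeas : ∀ ℓ, MeasurableSet (belowIO ℓ : Set (ℕ → ι × ℤ)) := fun ℓ => by
    simp only [belowIO, frequently_atTop, Set.ofPred_forall, Set.ofPred_exists, ← exists_prop]
    exact .iInter fun a => .iUnion fun b => .iUnion fun _ =>
      measurableSet_coord (A := {s : ι × ℤ | s.2 ≤ ℓ}) b
  have hzero : ∀ ℓ, (μ α i).real (belowIO ℓ) = 0 := by
    intro ℓ
    have hharm : ∀ β k, (μ β k).real (belowIO ℓ) =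
        stepMean Q p (fun β k => (μ β k).real (belowIO ℓ)) β k := fun β k => by
      rw [← hμ.real_shift h β k (hmeas ℓ)]
      congr 1
      ext ω
      have := Filter.map_add_atTop_eq_nat 1
      simp only [belowIO, Set.mem_ofPred_eq]
      conv_lhs => rw [← this, frequently_map]
    have hle : ∀ β k, (μ β k).real (belowIO ℓ) ≤ hitBelow Q p ℓ β k := fun β k => by
      rw [← hμ.real_hit_le h]
      exact measureReal_mono fun ω hω => hω.exists
    refine le_antisymm (ge_of_tendsto (by simpa using (hbelow i).add (hreturn ℓ)) ?_)
      measureReal_nonneg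
    filter_upwards [eventually_ge_atTop i.natAbs] with n hn
    refine le_trans ?_ (add_le_add_left (hitBelow_le_hitBelowMax (-n) α i) _)
    have := nonpos_of_le_stepMean h (a := -n) (b := n) (α := α) (i := i)
      (w := fun β k => (μ β k).real (belowIO ℓ) +
        -(hitBelow Q p (-n) β k + hitBelowMax Q p n ℓ))
      (fun β k hk _ => ?_) (fun β => ?_) (fun β => ?_) (by omega) (by omega)
    · linarith
    · rw [stepMean_add (fun β k => (μ β k).real (belowIO ℓ)), stepMean_neg,
        stepMean_add (hitBelow Q p (-n)) fun _ _ => _, stepMean_const h, ← hharm,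
        ← hitBelow_eq_stepMean h hk]
    · rw [hitBelow_of_le le_rfl]
      linarith [hitBelowMax_nonneg h n ℓ, measureReal_le_one (μ := μ β (-n)) (s := belowIO ℓ)]
    · linarith [hle β n, hitBelow_le_hitBelowMax (Q := Q) (p := p) ℓ β n,
        hitBelow_nonneg h (-n) β n]
  have hae : ∀ᵐ ω ∂μ α i, ∀ ℓ, ω ∉ belowIO ℓ := ae_all_iff.2 fun ℓ =>
    measure_eq_zero_iff_ae_notMem.1 ((measureReal_eq_zero_iff).1 (hzero ℓ))
  rw [← measure_univ (μ := μ α i)]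
  refine measure_congr ?_
  filter_upwards [hae] with ω hω
  refine propext ⟨fun _ => trivial, fun _ => ?_⟩
  refine tendsto_atTop.2 fun M => ?_
  have := hω M
  simp only [belowIO, Set.mem_ofPred_eq, not_frequently, not_le] at this
  exact this.mono fun n hn => hn.le

theorem IsQuenchedLaw.reflect (hμ : IsQuenchedLaw Q p μ) :
    IsQuenchedLaw Q (reflectEnv p) (reflectLaw μ) := by
  intro α i
  have := (hμ α (-i)).1
  refine ⟨Measure.isProbabilityMeasure_map measurable_reflectPath.aemeasurable, fun n t => ?_⟩
  rw [reflectLaw, Measure.map_apply measurable_reflectPath (measurableSet_cylinder n t)]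
  have hpre : reflectPath ⁻¹' {ω | ∀ k ≤ n, ω k = t k} = {ω | ∀ k ≤ n, ω k = reflectPath t k} := by
    ext ω
    simp only [reflectPath, Set.mem_preimage, Set.mem_ofPred_eq, Prod.ext_iff, neg_eq_iff_eq_neg]
  rw [hpre, (hμ α (-i)).2]
  congr 2
  · simp [reflectPath, Prod.ext_iff]
  · refine Finset.prod_congr rfl fun k _ => ?_
    have hr : -(t (k + 1)).2 = -(t k).2 + 1 ↔ (t (k + 1)).2 = (t k).2 - 1 := by omega
    have hl : -(t (k + 1)).2 = -(t k).2 - 1 ↔ (t (k + 1)).2 = (t k).2 + 1 := by omega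
    simp only [step, reflectPath, reflectEnv, hr, hl]
    congr 1
    split_ifs <;> first | omega | simp

end Law

theorem tendsto_zero_of_tendsto_log_div {x : ℕ → ℝ} (hx : ∀ n, 0 < x n) {γ : EReal} (hγ : γ < 0)
    (h : Tendsto (fun n : ℕ => ((Real.log (x n) / n : ℝ) : EReal)) atTop (𝓝 γ)) :
    Tendsto x atTop (𝓝 0) := by
  obtain ⟨c, hγc, hc⟩ := EReal.lt_iff_exists_real_btwn.1 hγ
  have hc0 : c < 0 := by exact_mod_cast hc
  have hexp : Tendsto (fun n : ℕ => Real.exp (c * n)) atTop (𝓝 0) :=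
    Real.tendsto_exp_atBot.comp (tendsto_natCast_atTop_atTop.const_mul_atTop_of_neg hc0)
  refine squeeze_zero' (.of_forall fun n => (hx n).le) ?_ hexp
  filter_upwards [h.eventually_lt_const hγc, eventually_gt_atTop 0] with n hn hn0
  rw [← Real.log_le_iff_le_exp (hx n), ← div_le_iff₀ (by exact_mod_cast hn0)]
  exact (EReal.coe_lt_coe_iff.1 hn).le

/-! ### Stationary families of crossing probabilities -/

section Stationary

variable {E : Type*} [MeasurableSpace E] {P : Measure E}

/-- `F i ℓ e` behaves like the probability of going from `i` to `(-∞, ℓ]` in the environment `e`: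
it is submultiplicative and its mean is translation invariant. -/
structure IsCrossing (P : Measure E) (F : ℤ → ℤ → E → ℝ) : Prop where
  measurable : ∀ i ℓ, Measurable (F i ℓ)
  pos : ∀ i ℓ e, 0 < F i ℓ e
  le_one : ∀ i ℓ e, F i ℓ e ≤ 1
  eq_one_of_le : ∀ i ℓ e, i ≤ ℓ → F i ℓ e = 1
  le_mul : ∀ i k ℓ e, ℓ ≤ k → k ≤ i → F i ℓ e ≤ F i k e * F k ℓ e
  integral_succ : ∀ i ℓ, ∫ e, F (i + 1) (ℓ + 1) e ∂P = ∫ e, F i ℓ e ∂P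

variable {F : ℤ → ℤ → E → ℝ}

theorem IsCrossing.antitone (hF : IsCrossing P F) {i i' ℓ ℓ' : ℤ} (hi : i ≤ i') (hℓ : ℓ' ≤ ℓ)
    (e : E) : F i' ℓ' e ≤ F i ℓ e := by
  have h1 : F i' ℓ' e ≤ F i' ℓ e := by
    rcases le_total ℓ i' with h | h
    · exact (hF.le_mul i' ℓ ℓ' e hℓ h).trans
        (mul_le_of_le_one_right (hF.pos ..).le (hF.le_one ..))
    · rw [hF.eq_one_of_le i' ℓ e h]
      exact hF.le_one ..
  refine h1.trans ?_
  rcases le_total ℓ i with h | h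
  · exact (hF.le_mul i' i ℓ e h hi).trans (mul_le_of_le_one_left (hF.pos ..).le (hF.le_one ..))
  · rw [hF.eq_one_of_le i ℓ e h]
    exact hF.le_one ..

theorem IsCrossing.sum_le_neg_log (hF : IsCrossing P F) (k n : ℕ) (e : E) :
    ∑ j ∈ Finset.range n, (1 - F ((j + 1 : ℕ) * k) (j * k) e) ≤ -Real.log (F (n * k) 0 e) := by
  induction n with
  | zero => simp [hF.eq_one_of_le]
  | succ n ih =>
    rw [Finset.sum_range_succ]
    have h1 := Real.log_le_log (hF.pos ..) (hF.le_mul ((n + 1 : ℕ) * k) (n * k) 0 e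
      (by positivity) (by push_cast; nlinarith))
    rw [Real.log_mul (hF.pos ..).ne' (hF.pos ..).ne'] at h1
    linarith [Real.log_le_sub_one_of_pos (hF.pos ((n + 1 : ℕ) * k) (n * k) e)]

theorem isCrossing_hitBelowMax {ι : Type*} [Fintype ι] [Nonempty ι] {Q : Matrix ι ι ℝ}
    {p : ι → ℤ → E → ℝ} (hp : ∀ α k, Measurable (p α k))
    (h : ∀ e, IsEnv Q fun α k => p α k e) {T : E → E} (hT : MeasurePreserving T P P)
    (hshift : (∀ α k e, p α k (T e) = p α (k + 1) e) ∨ ∀ α k e, p α k (T e) = p α (k - 1) e) :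
    IsCrossing P fun i ℓ e => hitBelowMax Q (fun α k => p α k e) i ℓ where
  measurable := measurable_hitBelowMax hp
  pos i ℓ e := hitBelowMax_pos (h e) i ℓ
  le_one i ℓ e := hitBelowMax_le_one (h e) i ℓ
  eq_one_of_le i ℓ e hi := hitBelowMax_of_le hi
  le_mul i k ℓ e hℓ hk := hitBelowMax_le_mul (h e) hℓ hk
  integral_succ i ℓ := by
    have hcomp : ∀ i ℓ, ∫ e, hitBelowMax Q (fun α k => p α k (T e)) i ℓ ∂P =
        ∫ e, hitBelowMax Q (fun α k => p α k e) i ℓ ∂P := fun i ℓ => by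
      conv_rhs => rw [← hT.map_eq]
      exact (integral_map_of_stronglyMeasurable hT.measurable
        (measurable_hitBelowMax hp i ℓ).stronglyMeasurable).symm
    rcases hshift with hs | hs
    · rw [← hcomp i ℓ]
      exact integral_congr_ae (ae_of_all _ fun e =>
        (hitBelowMax_shift (c := 1) (fun α k => hs α k e) i ℓ).symm)
    · rw [← hcomp (i + 1) (ℓ + 1)]
      refine integral_congr_ae (ae_of_all _ fun e => ?_)
      simpa using hitBelowMax_shift (Q := Q) (c := -1) (fun α k => hs α k e) (i + 1) (ℓ + 1)

theorem IsCrossing.integral_add (hF : IsCrossing P F) (i ℓ c : ℤ) :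
    ∫ e, F (i + c) (ℓ + c) e ∂P = ∫ e, F i ℓ e ∂P := by
  induction c with
  | zero => simp
  | succ c ih => rw [← ih, ← hF.integral_succ (i + c), add_assoc i, add_assoc ℓ]
  | pred c ih =>
    rw [← ih, ← hF.integral_succ, add_assoc, add_assoc, sub_add_cancel]

theorem IsCrossing.integral_eq (hF : IsCrossing P F) (i ℓ : ℤ) :
    ∫ e, F i ℓ e ∂P = ∫ e, F (i - ℓ) 0 e ∂P := by
  simpa using hF.integral_add (i - ℓ) 0 ℓ

variable [IsProbabilityMeasure P]

theorem IsCrossing.integrable (hF : IsCrossing P F) (i ℓ : ℤ) : Integrable (F i ℓ) P :=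
  Integrable.of_bound (hF.measurable i ℓ).aestronglyMeasurable 1
    (ae_of_all _ fun e => by simpa [abs_of_pos (hF.pos i ℓ e)] using hF.le_one i ℓ e)

theorem IsCrossing.tendsto_integral (hF : IsCrossing P F)
    (h0 : ∀ᵐ e ∂P, Tendsto (fun n : ℕ => F n 0 e) atTop (𝓝 0)) {u v : ℕ → ℤ}
    (huv : Tendsto (fun n => u n - v n) atTop atTop) :
    Tendsto (fun n => ∫ e, F (u n) (v n) e ∂P) atTop (𝓝 0) := by
  have hlim : Tendsto (fun n : ℕ => ∫ e, F n 0 e ∂P) atTop (𝓝 0) := by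
    simpa using tendsto_integral_of_dominated_convergence (fun _ => (1 : ℝ))
      (fun n => (hF.measurable n 0).aestronglyMeasurable) (integrable_const _)
      (fun n => ae_of_all _ fun e => by
        simpa [abs_of_pos (hF.pos n 0 e)] using hF.le_one n 0 e) h0
  have htoNat : Tendsto (fun n => (u n - v n).toNat) atTop atTop := by
    refine tendsto_atTop.2 fun b => ?_
    filter_upwards [huv.eventually_ge_atTop (b : ℤ)] with n hn
    omega
  refine (hlim.comp htoNat).congr' ?_
  filter_upwards [huv.eventually_ge_atTop 0] with n hn
  rw [hF.integral_eq (u n) (v n), Function.comp_apply, Int.toNat_of_nonneg hn]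

theorem IsCrossing.ae_tendsto_zero (hF : IsCrossing P F)
    (h0 : ∀ᵐ e ∂P, Tendsto (fun n : ℕ => F n 0 e) atTop (𝓝 0)) {u v : ℕ → ℤ}
    (hu : Monotone u) (hv : Antitone v) (huv : Tendsto (fun n => u n - v n) atTop atTop) :
    ∀ᵐ e ∂P, Tendsto (fun n => F (u n) (v n) e) atTop (𝓝 0) := by
  have hbdd : ∀ e, BddBelow (Set.range fun n => F (u n) (v n) e) := fun e =>
    ⟨0, Set.forall_mem_range.2 fun n => (hF.pos ..).le⟩
  have hlim : ∀ e, Tendsto (fun n => F (u n) (v n) e) atTop (𝓝 (⨅ n, F (u n) (v n) e)) :=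
    fun e => tendsto_atTop_ciInf (fun n n' hn => hF.antitone (hu hn) (hv hn) e) (hbdd e)
  have hnonneg : ∀ e, 0 ≤ ⨅ n, F (u n) (v n) e := fun e =>
    le_ciInf fun n => (hF.pos ..).le
  have hmeas : Measurable fun e => ⨅ n, F (u n) (v n) e :=
    Measurable.iInf fun n => hF.measurable ..
  have hint : Integrable (fun e => ⨅ n, F (u n) (v n) e) P :=
    Integrable.of_bound hmeas.aestronglyMeasurable 1 (ae_of_all _ fun e => by
      rw [Real.norm_of_nonneg (hnonneg e)]
      exact (ciInf_le (hbdd e) 0).trans (hF.le_one ..))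
  have hzero : ∫ e, ⨅ n, F (u n) (v n) e ∂P = 0 := by
    refine le_antisymm (ge_of_tendsto' (hF.tendsto_integral h0 huv) fun n => ?_)
      (integral_nonneg hnonneg)
    exact integral_mono hint (hF.integrable ..) fun e => ciInf_le (hbdd e) n
  filter_upwards [(integral_eq_zero_iff_of_nonneg hnonneg hint).1 hzero] with e he
  have := hlim e
  rwa [show ⨅ n, F (u n) (v n) e = 0 from he] at this

/-- If the crossing probabilities do not decay exponentially, they are all equal to one. -/
theorem IsCrossing.ae_eq_one (hF : IsCrossing P F)
    (h0 : ∀ᵐ e ∂P, Tendsto (fun n : ℕ => Real.log (F n 0 e) / n) atTop (𝓝 0)) :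
    ∀ᵐ e ∂P, ∀ i ℓ, ℓ ≤ i → F i ℓ e = 1 := by
  have hone : ∀ k : ℕ, 0 < k → ∫ e, F k 0 e ∂P = 1 := by
    intro k hk
    let A : ℕ → E → ℝ := fun n e =>
      (∑ j ∈ Finset.range n, (1 - F ((j + 1 : ℕ) * k) (j * k) e)) / n
    have hAmeas : ∀ n, Measurable (A n) := fun n =>
      (Finset.measurable_fun_sum _ fun j _ => measurable_const.sub (hF.measurable ..)).div_const _
    have hA0 : ∀ n e, 0 ≤ A n e := fun n e =>
      div_nonneg (Finset.sum_nonneg fun j _ => sub_nonneg.2 (hF.le_one ..)) n.cast_nonneg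
    have hA1 : ∀ n e, A n e ≤ 1 := fun n e => by
      refine div_le_one_of_le₀ ?_ n.cast_nonneg
      simpa using Finset.sum_le_sum (s := Finset.range n) fun j _ =>
        sub_le_self (1 : ℝ) (hF.pos ((j + 1 : ℕ) * k) (j * k) e).le
    have hAint : ∀ n : ℕ, 0 < n → ∫ e, A n e ∂P = 1 - ∫ e, F k 0 e ∂P := by
      intro n hn
      have hterm : ∀ j : ℕ, ∫ e, (1 - F ((j + 1 : ℕ) * k) (j * k) e) ∂P =
          1 - ∫ e, F k 0 e ∂P := fun j => by
        rw [integral_sub (integrable_const _) (hF.integrable ..), hF.integral_eq _ (j * k)]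
        simp [add_mul]
      have hintg : ∀ j : ℕ, Integrable (fun e => 1 - F ((j + 1 : ℕ) * k) (j * k) e) P :=
        fun j => (integrable_const _).sub (hF.integrable ..)
      rw [integral_div, integral_finsetSum _ fun j _ => hintg j]
      simp only [hterm, Finset.sum_const, Finset.card_range, nsmul_eq_mul]
      field_simp
    have hAlim : ∀ᵐ e ∂P, Tendsto (fun n => A n e) atTop (𝓝 0) := by
      filter_upwards [h0] with e he
      have hcomp := ((he.comp (tendsto_id.atTop_mul_const' hk)).mul_const (-(k : ℝ)))
      rw [zero_mul] at hcomp
      refine squeeze_zero' (.of_forall fun n => hA0 n e) ?_ hcomp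
      filter_upwards [eventually_gt_atTop 0] with n hn
      refine (div_le_div_of_nonneg_right (hF.sum_le_neg_log k n e) n.cast_nonneg).trans_eq ?_
      simp only [Function.comp_apply, id_eq, Nat.cast_mul]
      field_simp
    have hlim : Tendsto (fun n => ∫ e, A n e ∂P) atTop (𝓝 0) := by
      simpa using tendsto_integral_of_dominated_convergence (fun _ => (1 : ℝ))
        (fun n => (hAmeas n).aestronglyMeasurable) (integrable_const _)
        (fun n => ae_of_all _ fun e => by simpa [abs_of_nonneg (hA0 n e)] using hA1 n e) hAlim
    have hconst : Tendsto (fun n => ∫ e, A n e ∂P) atTop (𝓝 (1 - ∫ e, F k 0 e ∂P)) := by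
      refine tendsto_const_nhds.congr' ?_
      filter_upwards [eventually_gt_atTop 0] with n hn using (hAint n hn).symm
    linarith [tendsto_nhds_unique hlim hconst]
  refine ae_all_iff.2 fun i => ae_all_iff.2 fun ℓ => ?_
  rcases le_or_gt i ℓ with hi | hi
  · exact ae_of_all _ fun e _ => hF.eq_one_of_le i ℓ e hi
  have hint : ∫ e, (1 - F i ℓ e) ∂P = 0 := by
    rw [integral_sub (integrable_const _) (hF.integrable ..), hF.integral_eq,
      ← Int.toNat_of_nonneg (sub_nonneg.2 hi.le), hone _ (by omega)]
    simp
  filter_upwards [(integral_eq_zero_iff_of_nonneg (fun e => sub_nonneg.2 (hF.le_one i ℓ e))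
    ((integrable_const _).sub (hF.integrable i ℓ))).1 hint] with e he _
  exact (sub_eq_zero.1 he).symm

/-- If `‖f_{n,0}‖` decays exponentially, then the walk drifts to `+∞`. -/
theorem ae_driftTop {ι : Type*} [Fintype ι] [DecidableEq ι] [MeasurableSpace ι]
    [MeasurableSingletonClass ι] {Q : Matrix ι ι ℝ}
    {p : E → ι → ℤ → ℝ} (h : ∀ e, IsEnv Q (p e))
    (hF : IsCrossing P fun i ℓ e => hitBelowMax Q (p e) i ℓ)
    {μ : E → ι → ℤ → Measure (ℕ → ι × ℤ)} (hμ : ∀ e, IsQuenchedLaw Q (p e) (μ e))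
    (h0 : ∀ᵐ e ∂P, Tendsto (fun n : ℕ => hitBelowMax Q (p e) n 0) atTop (𝓝 0))
    (α : ι) (i : ℤ) : ∀ᵐ e ∂P, μ e α i driftTop = 1 := by
  have hbelow := ae_all_iff.2 fun i => hF.ae_tendsto_zero h0 (u := fun _ => i)
    (v := fun n => -(n : ℤ)) (fun _ _ _ => le_rfl) (fun _ _ hn => by dsimp only; omega)
    (by simpa using tendsto_atTop_add_const_left _ i tendsto_natCast_atTop_atTop)
  have hreturn := ae_all_iff.2 fun ℓ => hF.ae_tendsto_zero h0 (u := fun n => (n : ℤ))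
    (v := fun _ => ℓ) (fun _ _ hn => by dsimp only; omega) (fun _ _ _ => le_rfl)
    (tendsto_atTop_add_const_right _ (-ℓ) tendsto_natCast_atTop_atTop)
  filter_upwards [hbelow, hreturn] with e h1 h2
  exact (hμ e).driftTop (h e) h1 h2 α i

end Stationary

theorem reflectLaw_driftTop {ι : Type*} [Countable ι] [MeasurableSpace ι]
    [MeasurableSingletonClass ι] (μ : ι → ℤ → Measure (ℕ → ι × ℤ)) (α : ι) (i : ℤ) :
    reflectLaw μ α (-i) driftTop = μ α i driftBot := by
  have hmeas : MeasurableSet (driftTop : Set (ℕ → ι × ℤ)) := by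
    simp only [driftTop, tendsto_atTop, eventually_atTop, Set.ofPred_forall, Set.ofPred_exists]
    exact .iInter fun M => .iUnion fun a => .iInter fun b => .iInter fun _ =>
      measurableSet_coord (A := {s : ι × ℤ | M ≤ s.2}) b
  rw [reflectLaw, Measure.map_apply measurable_reflectPath hmeas, neg_neg]
  congr 1
  ext ω
  simp [driftTop, driftBot, reflectPath]

theorem fnorm_reflectLaw {ι : Type*} [Fintype ι] [MeasurableSpace ι]
    [MeasurableSingletonClass ι] (μ : ι → ℤ → Measure (ℕ → ι × ℤ)) (i : ℤ) :
    fnorm (reflectLaw μ) i 0 = fnorm μ (-i) 0 := by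
  have hmeas : MeasurableSet (hitEvent 0 : Set (ℕ → ι × ℤ)) := by
    simp only [hitEvent, ← exists_prop, Set.ofPred_exists]
    exact .iUnion fun n => .iUnion fun _ => measurableSet_coord (A := {s : ι × ℤ | s.2 = 0}) n
  refine iSup_congr fun α => ?_
  rw [reflectLaw, Measure.map_apply measurable_reflectPath hmeas]
  congr 2
  ext ω
  simp [hitEvent, reflectPath]

/-- A walk which a.s. reaches every half-line oscillates. -/
theorem IsQuenchedLaw.oscillate {ι : Type*} [Fintype ι] [DecidableEq ι] [MeasurableSpace ι]
    [MeasurableSingletonClass ι] {Q : Matrix ι ι ℝ} {p : ι → ℤ → ℝ}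
    {μ : ι → ℤ → Measure (ℕ → ι × ℤ)} (hμ : IsQuenchedLaw Q p μ) (h : IsEnv Q p)
    (hl : ∀ ℓ α i, hitBelow Q p ℓ α i = 1) (hr : ∀ ℓ α i, hitBelow Q (reflectEnv p) ℓ α i = 1)
    (α : ι) (i : ℤ) : μ α i oscillate = 1 := by
  have hprob := (hμ α i).1
  have hmeas : ∀ ℓ, MeasurableSet {ω : ℕ → ι × ℤ | ∃ n, (ω n).2 ≤ ℓ} := fun ℓ => by
    rw [Set.ofPred_exists]
    exact .iUnion fun n => measurableSet_coord (A := {s : ι × ℤ | s.2 ≤ ℓ}) n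
  have hlow : ∀ᵐ ω ∂μ α i, ∀ ℓ, ∃ n, (ω n).2 ≤ ℓ := ae_all_iff.2 fun ℓ => by
    have h1 := (hμ.real_hit_le h ℓ α i).trans (hl ℓ α i)
    exact (prob_compl_eq_zero_iff (hmeas ℓ)).2
      (by rw [← ENNReal.toReal_eq_one_iff]; exact h1)
  have hhigh : ∀ᵐ ω ∂μ α i, ∀ ℓ, ∃ n, -(ω n).2 ≤ ℓ := ae_all_iff.2 fun ℓ => by
    have h1 := (hμ.reflect.real_hit_le h.reflect ℓ α (-i)).trans (hr ℓ α (-i))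
    rw [reflectLaw, map_measureReal_apply measurable_reflectPath (hmeas ℓ), neg_neg] at h1
    exact (prob_compl_eq_zero_iff (measurable_reflectPath (hmeas ℓ))).2
      (by rw [← ENNReal.toReal_eq_one_iff]; exact h1)
  rw [← measure_univ (μ := μ α i)]
  refine measure_congr ?_
  filter_upwards [hlow, hhigh] with ω h1 h2
  refine propext ⟨fun _ => trivial, fun _ => ⟨fun M => ?_, fun M => ?_⟩⟩
  · refine frequently_atTop.2 fun N => ?_
    obtain ⟨n, hn⟩ := h1 (min M (-∑ k ∈ Finset.range N, |(ω k).2|) - 1)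
    refine ⟨n, not_lt.1 fun hnN => ?_, by omega⟩
    have := Finset.single_le_sum (fun k _ => abs_nonneg (ω k).2) (Finset.mem_range.2 hnN)
    have := neg_abs_le (ω n).2
    omega
  · refine frequently_atTop.2 fun N => ?_
    obtain ⟨n, hn⟩ := h2 (min (-M) (-∑ k ∈ Finset.range N, |(ω k).2|) - 1)
    refine ⟨n, not_lt.1 fun hnN => ?_, by omega⟩
    have := Finset.single_le_sum (fun k _ => abs_nonneg (ω k).2) (Finset.mem_range.2 hnN)
    have := le_abs_self (ω n).2
    omega

/-! ### Statement 7: Theorem `thm:main` -/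

theorem stmt7_thm_main {m : ℕ} (hm : 0 < m)
    {E : Type*} [MeasurableSpace E] (P : Measure E) [IsProbabilityMeasure P]
    (hPc : P.IsComplete) (T : E → E) (hT : Ergodic T P)
    (Q : Matrix (Fin m) (Fin m) ℝ)
    (hQ0 : ∀ α β, 0 ≤ Q α β) (hQ1 : ∀ α, ∑ β, Q α β = 1)
    (p : Fin m → ℤ → E → ℝ) (hpmeas : ∀ α k, Measurable (p α k))
    (hp01 : ∀ α k e, p α k e ∈ Set.Ioo (0 : ℝ) 1)
    (hpT : ∀ α k e, p α k (T e) = p α (k + 1) e)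
    (μ : E → Fin m → ℤ → Measure (ℕ → Fin m × ℤ))
    (hμ : ∀ e, IsQuenchedLaw Q (fun α k => p α k e) (μ e))
    (γp γm : EReal)
    (hγp : ∀ᵐ e ∂P, Tendsto
      (fun n : ℕ => ((Real.log (fnorm (μ e) n 0) / n : ℝ) : EReal)) atTop (𝓝 γp))
    (hγm : ∀ᵐ e ∂P, Tendsto
      (fun n : ℕ => ((Real.log (fnorm (μ e) (-n) 0) / n : ℝ) : EReal)) atTop (𝓝 γm)) :
    max γp γm = 0 ∧
    (ChainIrreducible Q →
      (γp < 0 ∧ γm = 0 → ∀ (α : Fin m) (i : ℤ), ∀ᵐ e ∂P, μ e α i driftTop = 1) ∧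
      (γp = 0 ∧ γm < 0 → ∀ (α : Fin m) (i : ℤ), ∀ᵐ e ∂P, μ e α i driftBot = 1) ∧
      (γp = 0 ∧ γm = 0 → ∀ (α : Fin m) (i : ℤ), ∀ᵐ e ∂P, μ e α i oscillate = 1)) := by
  have : Nonempty (Fin m) := ⟨⟨0, hm⟩⟩
  have henv : ∀ e, IsEnv Q fun α k => p α k e := fun e =>
    ⟨hQ0, hQ1, fun α k => (hp01 α k e).1, fun α k => (hp01 α k e).2⟩
  have hF := isCrossing_hitBelowMax hpmeas henv hT.toMeasurePreserving (.inl hpT)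
  have hF' : IsCrossing P fun i ℓ e => hitBelowMax Q (reflectEnv fun α k => p α k e) i ℓ :=
    isCrossing_hitBelowMax (p := fun α k e => 1 - p α (-k) e)
      (fun α k => measurable_const.sub (hpmeas α (-k))) (fun e => (henv e).reflect)
      hT.toMeasurePreserving (.inr fun α k e => by rw [hpT]; congr 2; ring)
  replace hγp : ∀ᵐ e ∂P, Tendsto (fun n : ℕ =>
      ((Real.log (hitBelowMax Q (fun α k => p α k e) n 0) / n : ℝ) : EReal)) atTop (𝓝 γp) := by
    filter_upwards [hγp] with e he
    refine he.congr' ?_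
    filter_upwards [eventually_gt_atTop 0] with n hn
    rw [(hμ e).fnorm_eq (henv e) (by exact_mod_cast hn)]
  replace hγm : ∀ᵐ e ∂P, Tendsto (fun n : ℕ => ((Real.log
      (hitBelowMax Q (reflectEnv fun α k => p α k e) n 0) / n : ℝ) : EReal)) atTop (𝓝 γm) := by
    filter_upwards [hγm] with e he
    refine he.congr' ?_
    filter_upwards [eventually_gt_atTop 0] with n hn
    rw [← fnorm_reflectLaw, (hμ e).reflect.fnorm_eq (henv e).reflect (by exact_mod_cast hn)]
  have hzero : ∀ {F : ℤ → ℤ → E → ℝ} {γ : EReal}, IsCrossing P F → γ < 0 →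
      (∀ᵐ e ∂P, Tendsto (fun n : ℕ => ((Real.log (F n 0 e) / n : ℝ) : EReal)) atTop (𝓝 γ)) →
      ∀ᵐ e ∂P, Tendsto (fun n : ℕ => F n 0 e) atTop (𝓝 0) := by
    intro F γ hF hγ h
    filter_upwards [h] with e he using
      tendsto_zero_of_tendsto_log_div (fun n => hF.pos n 0 e) hγ he
  have hnonpos : ∀ {F : ℤ → ℤ → E → ℝ} {γ : EReal}, IsCrossing P F →
      (∀ᵐ e ∂P, Tendsto (fun n : ℕ => ((Real.log (F n 0 e) / n : ℝ) : EReal)) atTop (𝓝 γ)) →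
      γ ≤ 0 := by
    intro F γ hF h
    obtain ⟨e, he⟩ := h.exists
    refine le_of_tendsto' he fun n => ?_
    exact_mod_cast div_nonpos_of_nonpos_of_nonneg
      (Real.log_nonpos (hF.pos n 0 e).le (hF.le_one n 0 e)) n.cast_nonneg
  have hone : ∀ {F : ℤ → ℤ → E → ℝ}, IsCrossing P F →
      (∀ᵐ e ∂P, Tendsto (fun n : ℕ => ((Real.log (F n 0 e) / n : ℝ) : EReal)) atTop (𝓝 0)) →
      ∀ᵐ e ∂P, ∀ i ℓ, ℓ ≤ i → F i ℓ e = 1 := by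
    intro F hF h
    refine hF.ae_eq_one ?_
    filter_upwards [h] with e he
    rw [← EReal.coe_zero] at he
    exact EReal.tendsto_coe.1 he
  refine ⟨?_, fun hirr => ⟨fun hγ α i => ?_, fun hγ α i => ?_, fun hγ α i => ?_⟩⟩
  · refine le_antisymm (max_le (hnonpos hF hγp) (hnonpos hF' hγm)) (not_lt.1 fun hlt => ?_)
    obtain ⟨hp, hm⟩ := max_lt_iff.1 hlt
    have huv : Tendsto (fun n : ℕ => (0 : ℤ) - -(n : ℤ)) atTop atTop := by
      simpa using tendsto_natCast_atTop_atTop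
    have hlim := (hF.tendsto_integral (hzero hF hp hγp) huv).add
      (hF'.tendsto_integral (hzero hF' hm hγm) huv)
    refine absurd (ge_of_tendsto' hlim fun n => ?_) (by norm_num : ¬ (1 : ℝ) ≤ 0 + 0)
    rw [← integral_add (hF.integrable ..) (hF'.integrable ..)]
    simpa using integral_mono (integrable_const (μ := P) (1 : ℝ))
      ((hF.integrable 0 (-n)).add (hF'.integrable 0 (-n)))
      fun e => one_le_hitBelowMax_add (henv e) n
  · have hlim := hzero hF hγ.1 hγp
    exact ae_driftTop (p := fun e α k => p α k e) henv hF hμ hlim α i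
  · have hlim := hzero hF' hγ.2 hγm
    filter_upwards [ae_driftTop (p := fun e => reflectEnv fun α k => p α k e)
      (μ := fun e => reflectLaw (μ e)) (fun e => (henv e).reflect) hF' (fun e => (hμ e).reflect)
      hlim α (-i)] with e he
    rwa [reflectLaw_driftTop] at he
  · rw [hγ.1] at hγp
    rw [hγ.2] at hγm
    filter_upwards [hone hF hγp, hone hF' hγm] with e h1 h2
    exact (hμ e).oscillate (henv e) (hitBelow_eq_one_of_irreducible (henv e) hirr h1)
      (hitBelow_eq_one_of_irreducible (henv e).reflect hirr h2) α i

end Parrondo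
end
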